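/- arXiv:1707.08732 — 2 statements merged into one kernel-verified Lean document; each statement's English description precedes it below -/
import Mathlib

section
/- Let e^{−ψ} : ℝ^{n+2} → ℝ≥0 be a log-concave density, E an n-dimensional linear subspace of ℝ^{n+2}, and for u ∈ E^⊥ \ {0} let H_u = E + ℝ≥0·u. Let x₀, x₁ ∈ E^⊥ be linearly independent, λ ∈ (0,1), x_λ = (1−λ)x₀ + λx₁, and let K₀ ⊆ H_{x₀}, K_λ ⊆ H_{x_λ}, K₁ ⊆ H_{x₁} be measurable sets such that for every t ∈ (0,1), ((1−t)K₀ + tK₁) ∩ H_{x_λ} ⊆ K_λ. Then |x_λ| / ∫_{K_λ} e^{−ψ} ≤ (1−λ)|x₀| / ∫_{K₀} e^{−ψ} + λ|x₁| / ∫_{K₁} e^{−ψ}, where the integrals are with respect to (n+1)-dimensional Hausdorff measure and are assumed positive and finite. -/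
open MeasureTheory Set Pointwise

/-- The one-dimensional Brunn–Minkowski inequality for two compact sets. -/
theorem volume_add_le_of_isCompact {A B C : Set ℝ} (hA : IsCompact A) (hB : IsCompact B)
    (hAne : A.Nonempty) (hBne : B.Nonempty) {l : ℝ} (hl : l ∈ Ioo (0 : ℝ) 1)
    (hC : ∀ a ∈ A, ∀ b ∈ B, (1 - l) * a + l * b ∈ C) :
    ENNReal.ofReal (1 - l) * volume A + ENNReal.ofReal l * volume B ≤ volume C := by
  obtain ⟨h0, h1⟩ := hl
  obtain ⟨a, haA, ha⟩ := hA.exists_isGreatest hAne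
  obtain ⟨b, hbB, hb⟩ := hB.exists_isLeast hBne
  set X : Set ℝ := (fun x => x + l * b) '' ((1 - l) • A) with hX
  set Y : Set ℝ := (fun x => (1 - l) * a + x) '' (l • B) with hY
  have hXc : IsCompact X := (hA.smul (1 - l)).image (by fun_prop)
  have hYc : IsCompact Y := (hB.smul l).image (by fun_prop)
  have hXv : volume X = ENNReal.ofReal (1 - l) * volume A := by
    rw [hX, image_add_right, measure_preimage_add_right, Measure.addHaar_smul]
    simp [abs_of_pos (sub_pos.2 h1)]
  have hYv : volume Y = ENNReal.ofReal l * volume B := by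
    rw [hY, image_add_left, measure_preimage_add, Measure.addHaar_smul]
    simp [abs_of_pos h0]
  have hd : AEDisjoint volume X Y := by
    refine measure_mono_null (t := {(1 - l) * a + l * b}) ?_ (by simp)
    rintro z ⟨⟨_, ⟨x, hx, rfl⟩, rfl⟩, ⟨_, ⟨y, hy, rfl⟩, hz⟩⟩
    have h2 := ha hx
    have h3 := hb hy
    simp only [smul_eq_mul, mem_singleton_iff] at hz ⊢
    nlinarith [mul_le_mul_of_nonneg_left h2 (sub_pos.2 h1).le, mul_le_mul_of_nonneg_left h3 h0.le]
  rw [← hXv, ← hYv, ← measure_union₀ hYc.measurableSet.nullMeasurableSet hd]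
  refine measure_mono (union_subset ?_ ?_)
  · rintro _ ⟨_, ⟨x, hx, rfl⟩, rfl⟩
    exact hC x hx b hbB
  · rintro _ ⟨_, ⟨y, hy, rfl⟩, rfl⟩
    exact hC a haA y hy

/-- The one-dimensional Brunn–Minkowski inequality for measurable sets. -/
theorem volume_add_le {A B C : Set ℝ} (hA : MeasurableSet A) (hB : MeasurableSet B)
    (hAne : A.Nonempty) (hBne : B.Nonempty) {l : ℝ} (hl : l ∈ Ioo (0 : ℝ) 1)
    (hC : ∀ a ∈ A, ∀ b ∈ B, (1 - l) * a + l * b ∈ C) :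
    ENNReal.ofReal (1 - l) * volume A + ENNReal.ofReal l * volume B ≤ volume C := by
  obtain ⟨a, ha⟩ := hAne
  obtain ⟨b, hb⟩ := hBne
  have key {S : Set ℝ} (hS : MeasurableSet S) :
      volume S = ⨆ (K) (_ : K ⊆ S ∧ IsCompact K), volume K := by
    rw [hS.measure_eq_iSup_isCompact]
    simp only [iSup_and]
  rw [key hA, key hB]
  simp only [ENNReal.mul_iSup]
  refine ENNReal.biSup_add_biSup_le' ⟨∅, empty_subset _, isCompact_empty⟩
    ⟨∅, empty_subset _, isCompact_empty⟩ fun K hK L hL => ?_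
  calc _ ≤ ENNReal.ofReal (1 - l) * volume (insert a K)
        + ENNReal.ofReal l * volume (insert b L) := by
        gcongr <;> exact subset_insert _ _
    _ ≤ volume C := volume_add_le_of_isCompact (hK.2.insert a) (hL.2.insert b)
        (insert_nonempty _ _) (insert_nonempty _ _) hl fun x hx y hy =>
          hC x (insert_subset ha hK.1 hx) y (insert_subset hb hL.1 hy)

/-- Layer-cake formula for functions bounded by one. -/
theorem lintegral_eq_lintegral_meas_ofReal_lt {f : ℝ → ENNReal} (hf : Measurable f)
    (hf1 : ∀ x, f x ≤ 1) :
    ∫⁻ x, f x = ∫⁻ t in Ioi (0 : ℝ), volume {x | ENNReal.ofReal t < f x} := by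
  have hfin : ∀ x, f x ≠ ⊤ := fun x => ne_top_of_le_ne_top ENNReal.one_ne_top (hf1 x)
  have := lintegral_eq_lintegral_meas_lt volume (f := fun x => (f x).toReal)
    (Filter.Eventually.of_forall fun x => ENNReal.toReal_nonneg) hf.ennreal_toReal.aemeasurable
  simp only [ENNReal.ofReal_toReal (hfin _)] at this
  rw [this]
  refine setLIntegral_congr_fun measurableSet_Ioi fun t ht => ?_
  have ht : 0 < t := ht
  simp only [ENNReal.ofReal_lt_iff_lt_toReal ht.le (hfin _)]

/-- One-dimensional functional Brunn–Minkowski inequality for functions with supremum one. -/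
theorem lintegral_add_le_of_min_le {f g h : ℝ → ENNReal} (hf : Measurable f) (hg : Measurable g)
    (hh : Measurable h) (hf1 : ∀ x, f x ≤ 1) (hg1 : ∀ x, g x ≤ 1)
    (hfs : ∀ s < 1, ∃ x, s < f x) (hgs : ∀ s < 1, ∃ x, s < g x)
    {l : ℝ} (hl : l ∈ Ioo (0 : ℝ) 1)
    (hfgh : ∀ x y, min (f x) (g y) ≤ h ((1 - l) * x + l * y)) :
    ENNReal.ofReal (1 - l) * (∫⁻ x, f x) + ENNReal.ofReal l * (∫⁻ x, g x) ≤ ∫⁻ x, h x := by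
  have hh' : Measurable fun x => min (h x) 1 := hh.min measurable_const
  calc _ ≤ ∫⁻ x, min (h x) 1 := ?_
    _ ≤ ∫⁻ x, h x := lintegral_mono fun x => min_le_left _ _
  rw [lintegral_eq_lintegral_meas_ofReal_lt hf hf1, lintegral_eq_lintegral_meas_ofReal_lt hg hg1,
    lintegral_eq_lintegral_meas_ofReal_lt hh' fun x => min_le_right _ _]
  refine (add_le_add (lintegral_const_mul_le _ _) (lintegral_const_mul_le _ _)).trans <|
    (le_lintegral_add _ _).trans <| lintegral_mono fun t => ?_
  simp only
  rcases lt_or_ge (ENNReal.ofReal t) 1 with ht | ht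
  · refine volume_add_le (hf measurableSet_Ioi) (hg measurableSet_Ioi) (hfs _ ht) (hgs _ ht) hl ?_
    intro a ha b hb
    exact lt_min ((lt_min ha hb).trans_le (hfgh a b)) ht
  · have h1 : {x | ENNReal.ofReal t < f x} = ∅ := by
      ext x; simpa using (hf1 x).trans ht
    have h2 : {x | ENNReal.ofReal t < g x} = ∅ := by
      ext x; simpa using (hg1 x).trans ht
    simp [h1, h2]

/-- Scaled version of `lintegral_add_le_of_min_le` for functions with finite suprema. -/
theorem mul_lintegral_add_le_of_min_le {f g h : ℝ → ENNReal} (hf : Measurable f)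
    (hg : Measurable g) (hh : Measurable h) {A B M : ENNReal}
    (hA : ⨆ x, f x = A) (hB : ⨆ x, g x = B) (hA0 : A ≠ 0) (hB0 : B ≠ 0) (hAt : A ≠ ⊤)
    (hBt : B ≠ ⊤) (hM0 : M ≠ 0) (hMt : M ≠ ⊤) {l : ℝ} (hl : l ∈ Ioo (0 : ℝ) 1)
    (hfgh : ∀ x y, M * min (f x / A) (g y / B) ≤ h ((1 - l) * x + l * y)) :
    M * (ENNReal.ofReal (1 - l) * ((∫⁻ x, f x) / A) + ENNReal.ofReal l * ((∫⁻ x, g x) / B))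
      ≤ ∫⁻ x, h x := by
  have key {f : ℝ → ENNReal} {A : ENNReal} (hA : ⨆ x, f x = A) (hA0 : A ≠ 0) (hAt : A ≠ ⊤) :
      (∀ x, f x / A ≤ 1) ∧ ∀ s < 1, ∃ x, s < f x / A := by
    refine ⟨fun x => ENNReal.div_le_of_le_mul (by simpa [← hA] using le_iSup f x), fun s hs => ?_⟩
    have : s * A < ⨆ x, f x := by
      rw [hA]
      simpa using ENNReal.mul_lt_mul_left hA0 hAt hs
    obtain ⟨x, hx⟩ := lt_iSup_iff.1 this
    exact ⟨x, (ENNReal.lt_div_iff_mul_lt (.inl hA0) (.inl hAt)).2 hx⟩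
  have := lintegral_add_le_of_min_le (f := fun x => f x / A) (g := fun x => g x / B)
    (h := fun x => h x / M) (hf.div_const _) (hg.div_const _) (hh.div_const _)
    (key hA hA0 hAt).1 (key hB hB0 hBt).1 (key hA hA0 hAt).2 (key hB hB0 hBt).2 hl
    (fun x y => (ENNReal.le_div_iff_mul_le (.inl hM0) (.inl hMt)).2 (mul_comm M _ ▸ hfgh x y))
  simp only [div_eq_mul_inv] at this ⊢
  rw [lintegral_mul_const _ hf, lintegral_mul_const _ hg, lintegral_mul_const _ hh,
    ← div_eq_mul_inv _ M, ENNReal.le_div_iff_mul_le (.inl hM0) (.inl hMt), mul_comm] at this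
  exact this

theorem iSup_lintegral_min_natCast {α : Type*} [MeasurableSpace α] {μ : Measure α}
    {f : α → ENNReal} (hf : Measurable f) :
    ⨆ N : ℕ, ∫⁻ x, min (f x) N ∂μ = ∫⁻ x, f x ∂μ := by
  rw [← lintegral_iSup fun N => hf.min measurable_const]
  · congr 1 with x
    rw [← inf_iSup_eq, ENNReal.iSup_natCast, inf_top_eq]
  · exact fun m n hmn x => min_le_min le_rfl (by exact_mod_cast hmn)

theorem ENNReal.rpow_mul_rpow_le_add {t : ℝ} (ht : t ∈ Ioo (0 : ℝ) 1) (p q : ENNReal) :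
    p ^ (1 - t) * q ^ t ≤ ENNReal.ofReal (1 - t) * p + ENNReal.ofReal t * q := by
  have h0 := ht.1
  have h1 : 0 < 1 - t := sub_pos.2 ht.2
  rcases eq_or_ne p ⊤ with rfl | hp
  · rw [ENNReal.mul_top (ENNReal.ofReal_pos.2 h1).ne', top_add]
    exact le_top
  rcases eq_or_ne q ⊤ with rfl | hq
  · rw [ENNReal.mul_top (ENNReal.ofReal_pos.2 h0).ne', add_top]
    exact le_top
  rw [← ENNReal.ofReal_toReal hp, ← ENNReal.ofReal_toReal hq,
    ENNReal.ofReal_rpow_of_nonneg ENNReal.toReal_nonneg h1.le,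
    ENNReal.ofReal_rpow_of_nonneg ENNReal.toReal_nonneg h0.le,
    ← ENNReal.ofReal_mul (by positivity), ← ENNReal.ofReal_mul h1.le, ← ENNReal.ofReal_mul h0.le,
    ← ENNReal.ofReal_add (by positivity) (by positivity)]
  exact ENNReal.ofReal_le_ofReal (Real.geom_mean_le_arith_mean2_weighted h1.le h0.le
    ENNReal.toReal_nonneg ENNReal.toReal_nonneg (by ring))

/-- The Prékopa–Leindler inequality, as a property of a measure on a real vector space. -/
def PrekopaLeindler {V : Type*} [AddCommGroup V] [Module ℝ V] [MeasurableSpace V]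
    (μ : Measure V) : Prop :=
  ∀ t ∈ Ioo (0 : ℝ) 1, ∀ f g h : V → ENNReal, Measurable f → Measurable g → Measurable h →
    (∀ x y, f x ^ (1 - t) * g y ^ t ≤ h ((1 - t) • x + t • y)) →
    (∫⁻ x, f x ∂μ) ^ (1 - t) * (∫⁻ x, g x ∂μ) ^ t ≤ ∫⁻ x, h x ∂μ

theorem prekopa_leindler_of_bounded {t : ℝ} (ht : t ∈ Ioo (0 : ℝ) 1) {f g h : ℝ → ENNReal}
    (hf : Measurable f) (hg : Measurable g) (hh : Measurable h) {C : ENNReal} (hC : C ≠ ⊤)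
    (hfC : ∀ x, f x ≤ C) (hgC : ∀ x, g x ≤ C)
    (hfgh : ∀ x y, f x ^ (1 - t) * g y ^ t ≤ h ((1 - t) * x + t * y)) :
    (∫⁻ x, f x) ^ (1 - t) * (∫⁻ x, g x) ^ t ≤ ∫⁻ x, h x := by
  have h0 := ht.1
  have h1 : 0 < 1 - t := sub_pos.2 ht.2
  rcases eq_or_ne (⨆ x, f x) 0 with hA0 | hA0
  · simp [ENNReal.iSup_eq_zero.1 hA0, h1]
  rcases eq_or_ne (⨆ x, g x) 0 with hB0 | hB0
  · simp [ENNReal.iSup_eq_zero.1 hB0, h0]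
  have hAt : (⨆ x, f x) ≠ ⊤ := ne_top_of_le_ne_top hC (iSup_le hfC)
  have hBt : (⨆ x, g x) ≠ ⊤ := ne_top_of_le_ne_top hC (iSup_le hgC)
  set A := ⨆ x, f x with hA
  set B := ⨆ x, g x with hB
  have key (p q : ENNReal) :
      A ^ (1 - t) * B ^ t * ((p / A) ^ (1 - t) * (q / B) ^ t) = p ^ (1 - t) * q ^ t := by
    rw [mul_mul_mul_comm, ← ENNReal.mul_rpow_of_nonneg _ _ h1.le,
      ← ENNReal.mul_rpow_of_nonneg _ _ h0.le, ENNReal.mul_div_cancel hA0 hAt,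
      ENNReal.mul_div_cancel hB0 hBt]
  rw [← key]
  refine le_trans (mul_le_mul_right (ENNReal.rpow_mul_rpow_le_add ht _ _) _)
    (mul_lintegral_add_le_of_min_le hf hg hh hA.symm hB.symm hA0 hB0 hAt hBt ?_ ?_ ht ?_)
  · exact mul_ne_zero (by simp [hA0, hAt]) (by simp [hB0, hBt])
  · exact ENNReal.mul_ne_top (ENNReal.rpow_ne_top_of_nonneg h1.le hAt)
      (ENNReal.rpow_ne_top_of_nonneg h0.le hBt)
  · intro x y
    refine le_trans ?_ ((key (f x) (g y)).trans_le (hfgh x y))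
    gcongr
    calc min (f x / A) (g y / B)
        = min (f x / A) (g y / B) ^ (1 - t) * min (f x / A) (g y / B) ^ t := by
          rw [← ENNReal.rpow_add_of_nonneg _ _ h1.le h0.le]; simp
      _ ≤ _ := by
          gcongr
          · exact min_le_left _ _
          · exact min_le_right _ _

/-- The one-dimensional Prékopa–Leindler inequality. -/
theorem prekopaLeindler_real : PrekopaLeindler (volume : Measure ℝ) := by
  intro t ht f g h hf hg hh hfgh
  have h0 := ht.1
  have h1 : 0 < 1 - t := sub_pos.2 ht.2
  have hpow {s : ℝ} (hs : 0 < s) (u : ℕ → ENNReal) : (⨆ N, u N) ^ s = ⨆ N, u N ^ s :=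
    (ENNReal.orderIsoRpow s hs).map_iSup u
  rw [← iSup_lintegral_min_natCast hf, ← iSup_lintegral_min_natCast hg, hpow h1, hpow h0]
  simp only [ENNReal.iSup_mul, ENNReal.mul_iSup]
  refine iSup_le fun N => iSup_le fun M => ?_
  refine prekopa_leindler_of_bounded ht (hf.min measurable_const) (hg.min measurable_const) hh
    (C := max (N : ENNReal) M) (by simp) (fun x => (min_le_right _ _).trans (le_max_right _ _))
    (fun x => (min_le_right _ _).trans (le_max_left _ _)) fun x y => ?_
  refine le_trans ?_ (hfgh x y)
  gcongr
  · exact min_le_left _ _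
  · exact min_le_left _ _

theorem PrekopaLeindler.prod {V W : Type*} [AddCommGroup V] [Module ℝ V] [MeasurableSpace V]
    [AddCommGroup W] [Module ℝ W] [MeasurableSpace W] {μ : Measure V} {ν : Measure W} [SFinite ν]
    (hμ : PrekopaLeindler μ) (hν : PrekopaLeindler ν) : PrekopaLeindler (μ.prod ν) := by
  intro t ht f g h hf hg hh hfgh
  rw [lintegral_prod _ hf.aemeasurable, lintegral_prod _ hg.aemeasurable,
    lintegral_prod _ hh.aemeasurable]
  refine hμ t ht _ _ _ hf.lintegral_prod_right' hg.lintegral_prod_right' hh.lintegral_prod_right'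
    fun x y => hν t ht _ _ _ (hf.comp measurable_prodMk_left) (hg.comp measurable_prodMk_left)
      (hh.comp measurable_prodMk_left) fun z w => hfgh (x, z) (y, w)

/-- The Prékopa–Leindler inequality in `ℝⁿ`. -/
theorem prekopaLeindler_pi (n : ℕ) : PrekopaLeindler (volume : Measure (Fin n → ℝ)) := by
  induction n with
  | zero =>
    intro t ht f g h hf hg hh hfgh
    simp only [volume_pi, Measure.pi_of_empty (x := (0 : Fin 0 → ℝ)), lintegral_dirac]
    simpa using hfgh 0 0
  | succ n ih =>
    intro t ht f g h hf hg hh hfgh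
    have he := (volume_preserving_piFinSuccAbove (fun _ : Fin (n + 1) => ℝ) 0).symm
    rw [← he.lintegral_comp hf, ← he.lintegral_comp hg, ← he.lintegral_comp hh]
    refine (prekopaLeindler_real.prod ih) t ht _ _ _ (hf.comp he.measurable)
      (hg.comp he.measurable) (hh.comp he.measurable) fun x y => (hfgh _ _).trans_eq ?_
    congr 1
    ext i
    refine Fin.cases ?_ (fun i => ?_) i <;> simp [MeasurableEquiv.piFinSuccAbove]

theorem inv_mul_add_le_of_sq_inv {l α β : ℝ} (hl : l ∈ Ioo (0 : ℝ) 1) (hα : 0 < α) (hβ : 0 < β)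
    {P Q : ENNReal} :
    (ENNReal.ofReal ((((1 - l) * α + l * β) ^ 2)⁻¹) *
      (ENNReal.ofReal (1 - l) * (P / ENNReal.ofReal ((α ^ 2)⁻¹)) +
        ENNReal.ofReal l * (Q / ENNReal.ofReal ((β ^ 2)⁻¹))))⁻¹
      ≤ ENNReal.ofReal (1 - l) * P⁻¹ + ENNReal.ofReal l * Q⁻¹ := by
  have h0 := hl.1
  have h1 : 0 < 1 - l := sub_pos.2 hl.2
  have e0 : ENNReal.ofReal l ≠ 0 := (ENNReal.ofReal_pos.2 h0).ne'
  have e1 : ENNReal.ofReal (1 - l) ≠ 0 := (ENNReal.ofReal_pos.2 h1).ne'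
  have hM : ENNReal.ofReal ((((1 - l) * α + l * β) ^ 2)⁻¹) ≠ 0 :=
    (ENNReal.ofReal_pos.2 (by positivity)).ne'
  rcases eq_or_ne P 0 with rfl | hP0
  · simp [ENNReal.mul_top e1]
  rcases eq_or_ne Q 0 with rfl | hQ0
  · simp [ENNReal.mul_top e0]
  rcases eq_or_ne P ⊤ with rfl | hP
  · rw [ENNReal.top_div_of_ne_top ENNReal.ofReal_ne_top, ENNReal.mul_top e1, top_add,
      ENNReal.mul_top hM]
    simp
  rcases eq_or_ne Q ⊤ with rfl | hQ
  · rw [ENNReal.top_div_of_ne_top ENNReal.ofReal_ne_top, ENNReal.mul_top e0, add_top,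
      ENNReal.mul_top hM]
    simp
  obtain ⟨p, rfl⟩ : ∃ p, P = ENNReal.ofReal p := ⟨_, (ENNReal.ofReal_toReal hP).symm⟩
  obtain ⟨q, rfl⟩ : ∃ q, Q = ENNReal.ofReal q := ⟨_, (ENNReal.ofReal_toReal hQ).symm⟩
  have hp : 0 < p := by simpa using hP0
  have hq : 0 < q := by simpa using hQ0
  rw [← ENNReal.ofReal_div_of_pos (by positivity), ← ENNReal.ofReal_div_of_pos (by positivity),
    ← ENNReal.ofReal_inv_of_pos hp, ← ENNReal.ofReal_inv_of_pos hq, ← ENNReal.ofReal_mul h1.le,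
    ← ENNReal.ofReal_mul h0.le, ← ENNReal.ofReal_mul h1.le, ← ENNReal.ofReal_mul h0.le,
    ← ENNReal.ofReal_add (by positivity) (by positivity),
    ← ENNReal.ofReal_add (by positivity) (by positivity), ← ENNReal.ofReal_mul (by positivity),
    ← ENNReal.ofReal_inv_of_pos (by positivity)]
  refine ENNReal.ofReal_le_ofReal ?_
  rw [mul_inv, inv_inv, ← div_eq_mul_inv, div_le_iff₀ (by positivity), ← sub_nonneg]
  have : ((1 - l) * p⁻¹ + l * q⁻¹) * ((1 - l) * (p / (α ^ 2)⁻¹) + l * (q / (β ^ 2)⁻¹)) -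
      ((1 - l) * α + l * β) ^ 2 = (1 - l) * l * (q * β - p * α) ^ 2 / (p * q) := by
    field_simp
    ring
  rw [this]
  positivity

theorem inv_lintegral_le_of_bounded {l : ℝ} (hl : l ∈ Ioo (0 : ℝ) 1) {f g h : ℝ → ENNReal}
    (hf : Measurable f) (hg : Measurable g) (hh : Measurable h) {C : ENNReal} (hC : C ≠ ⊤)
    (hfC : ∀ x, f x ≤ C) (hgC : ∀ x, g x ≤ C)
    (hfgh : ∀ x y α β : ℝ, 0 < α → 0 < β → ENNReal.ofReal ((α ^ 2)⁻¹) ≤ f x →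
      ENNReal.ofReal ((β ^ 2)⁻¹) ≤ g y →
      ENNReal.ofReal ((((1 - l) * α + l * β) ^ 2)⁻¹) ≤ h ((1 - l) * x + l * y)) :
    (∫⁻ x, h x)⁻¹ ≤ ENNReal.ofReal (1 - l) * (∫⁻ x, f x)⁻¹ +
      ENNReal.ofReal l * (∫⁻ x, g x)⁻¹ := by
  have h0 := hl.1
  have h1 : 0 < 1 - l := sub_pos.2 hl.2
  have e0 : ENNReal.ofReal l ≠ 0 := (ENNReal.ofReal_pos.2 h0).ne'
  have e1 : ENNReal.ofReal (1 - l) ≠ 0 := (ENNReal.ofReal_pos.2 h1).ne'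
  have key {f : ℝ → ENNReal} (hfC : ∀ x, f x ≤ C) (hf0 : ⨆ x, f x ≠ 0) :
      ∃ α : ℝ, 0 < α ∧ ⨆ x, f x = ENNReal.ofReal ((α ^ 2)⁻¹) := by
    have ht : ⨆ x, f x ≠ ⊤ := ne_top_of_le_ne_top hC (iSup_le hfC)
    have hpos := ENNReal.toReal_pos hf0 ht
    refine ⟨(√(⨆ x, f x).toReal)⁻¹, by positivity, ?_⟩
    rw [inv_pow, inv_inv, Real.sq_sqrt hpos.le, ENNReal.ofReal_toReal ht]
  rcases eq_or_ne (⨆ x, f x) 0 with hA0 | hA0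
  · simp [ENNReal.iSup_eq_zero.1 hA0, ENNReal.mul_top e1]
  rcases eq_or_ne (⨆ x, g x) 0 with hB0 | hB0
  · simp [ENNReal.iSup_eq_zero.1 hB0, ENNReal.mul_top e0]
  obtain ⟨α, hα, hA⟩ := key hfC hA0
  obtain ⟨β, hβ, hB⟩ := key hgC hB0
  refine le_trans (ENNReal.inv_le_inv.2 ?_) (inv_mul_add_le_of_sq_inv hl hα hβ)
  refine mul_lintegral_add_le_of_min_le hf hg hh hA hB (hA ▸ hA0) (hB ▸ hB0)
    ENNReal.ofReal_ne_top ENNReal.ofReal_ne_top (ENNReal.ofReal_pos.2 (by positivity)).ne'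
    ENNReal.ofReal_ne_top hl fun x y => ?_
  set s := min (f x / ENNReal.ofReal ((α ^ 2)⁻¹)) (g y / ENNReal.ofReal ((β ^ 2)⁻¹)) with hs
  rcases eq_or_ne s 0 with hs0 | hs0
  · simp [hs0]
  have hst : s ≠ ⊤ := by
    refine ne_top_of_le_ne_top (ENNReal.div_ne_top (ne_top_of_le_ne_top hC (hfC x)) (hA ▸ hA0))
      (min_le_left _ _)
  obtain ⟨σ, hσ, hsσ⟩ : ∃ σ : ℝ, 0 < σ ∧ s = ENNReal.ofReal ((σ ^ 2)⁻¹) := by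
    have hpos := ENNReal.toReal_pos hs0 hst
    refine ⟨(√s.toReal)⁻¹, by positivity, ?_⟩
    rw [inv_pow, inv_inv, Real.sq_sqrt hpos.le, ENNReal.ofReal_toReal hst]
  have hmul (γ : ℝ) : ENNReal.ofReal (((σ * γ) ^ 2)⁻¹) = s * ENNReal.ofReal ((γ ^ 2)⁻¹) := by
    rw [hsσ, ← ENNReal.ofReal_mul (by positivity), mul_pow, mul_inv]
  have := hfgh x y (σ * α) (σ * β) (by positivity) (by positivity)
    (by rw [hmul]; exact ENNReal.mul_le_of_le_div (min_le_left _ _))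
    (by rw [hmul]; exact ENNReal.mul_le_of_le_div (min_le_right _ _))
  rwa [show (1 - l) * (σ * α) + l * (σ * β) = σ * ((1 - l) * α + l * β) by ring, hmul,
    mul_comm] at this

/-- A one-dimensional Borell–Brascamp–Lieb inequality: if `h` dominates the mean of exponent `-1/2`
of `f` and `g`, then the integral of `h` dominates the harmonic mean of their integrals. -/
theorem inv_lintegral_le {l : ℝ} (hl : l ∈ Ioo (0 : ℝ) 1) {f g h : ℝ → ENNReal}
    (hf : Measurable f) (hg : Measurable g) (hh : Measurable h)
    (hfgh : ∀ x y α β : ℝ, 0 < α → 0 < β → ENNReal.ofReal ((α ^ 2)⁻¹) ≤ f x →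
      ENNReal.ofReal ((β ^ 2)⁻¹) ≤ g y →
      ENNReal.ofReal ((((1 - l) * α + l * β) ^ 2)⁻¹) ≤ h ((1 - l) * x + l * y)) :
    (∫⁻ x, h x)⁻¹ ≤ ENNReal.ofReal (1 - l) * (∫⁻ x, f x)⁻¹ +
      ENNReal.ofReal l * (∫⁻ x, g x)⁻¹ := by
  have key {f : ℝ → ENNReal} (hf : Measurable f) : Filter.Tendsto
      (fun N : ℕ => (∫⁻ x, min (f x) N)⁻¹) Filter.atTop (nhds (∫⁻ x, f x)⁻¹) := by
    rw [← iSup_lintegral_min_natCast hf]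
    exact tendsto_inv_iff.2 (tendsto_atTop_iSup fun m n hmn =>
      lintegral_mono fun x => min_le_min le_rfl (by exact_mod_cast hmn))
  refine ge_of_tendsto' ((ENNReal.Tendsto.const_mul (key hf) (.inr ENNReal.ofReal_ne_top)).add
    (ENNReal.Tendsto.const_mul (key hg) (.inr ENNReal.ofReal_ne_top))) fun N => ?_
  exact inv_lintegral_le_of_bounded hl (hf.min measurable_const) (hg.min measurable_const) hh
    (ENNReal.natCast_ne_top N) (fun x => min_le_right _ _) (fun x => min_le_right _ _)
    fun x y α β hα hβ hx hy =>
      hfgh x y α β hα hβ (hx.trans (min_le_left _ _)) (hy.trans (min_le_left _ _))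

theorem lintegral_Ioi_inv (f : ℝ → ENNReal) :
    ∫⁻ r in Ioi (0 : ℝ), f r = ∫⁻ x in Ioi (0 : ℝ), ENNReal.ofReal ((x ^ 2)⁻¹) * f x⁻¹ := by
  have himg : (fun x : ℝ => x⁻¹) '' Ioi 0 = Ioi 0 := by
    ext x
    simp
  have := lintegral_image_eq_lintegral_abs_deriv_mul measurableSet_Ioi
    (fun x (hx : x ∈ Ioi (0 : ℝ)) => (hasDerivAt_inv (ne_of_gt hx)).hasDerivWithinAt)
    inv_injective.injOn f
  rw [himg] at this
  refine this.trans (setLIntegral_congr_fun measurableSet_Ioi fun x hx => ?_)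
  rw [abs_neg, abs_of_nonneg (by positivity)]

/-- A Busemann-type inequality on the half-line, with respect to harmonic combinations. -/
theorem inv_setLIntegral_Ioi_le {l : ℝ} (hl : l ∈ Ioo (0 : ℝ) 1) {f g h : ℝ → ENNReal}
    (hf : Measurable f) (hg : Measurable g) (hh : Measurable h)
    (hfgh : ∀ r s c t : ℝ, 0 < r → 0 < s → 0 < c → t ∈ Ioo (0 : ℝ) 1 →
      (1 - t) * r = c * (1 - l) → t * s = c * l → f r ^ (1 - t) * g s ^ t ≤ h c) :
    (∫⁻ r in Ioi (0 : ℝ), h r)⁻¹ ≤ ENNReal.ofReal (1 - l) * (∫⁻ r in Ioi (0 : ℝ), f r)⁻¹ +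
      ENNReal.ofReal l * (∫⁻ r in Ioi (0 : ℝ), g r)⁻¹ := by
  have h0 := hl.1
  have h1 : 0 < 1 - l := sub_pos.2 hl.2
  have hmeas {f : ℝ → ENNReal} (hf : Measurable f) :
      Measurable fun x : ℝ => ENNReal.ofReal ((x ^ 2)⁻¹) * f x⁻¹ :=
    (Measurable.ennreal_ofReal (by fun_prop)).mul (hf.comp measurable_inv)
  rw [lintegral_Ioi_inv f, lintegral_Ioi_inv g, lintegral_Ioi_inv h,
    ← lintegral_indicator measurableSet_Ioi, ← lintegral_indicator measurableSet_Ioi,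
    ← lintegral_indicator measurableSet_Ioi]
  refine inv_lintegral_le hl ((hmeas hf).indicator measurableSet_Ioi)
    ((hmeas hg).indicator measurableSet_Ioi) ((hmeas hh).indicator measurableSet_Ioi)
    fun x y α β hα hβ hx hy => ?_
  have key {f : ℝ → ENNReal} {x α : ℝ} (hα : 0 < α) (hx : ENNReal.ofReal ((α ^ 2)⁻¹) ≤
      (Ioi (0 : ℝ)).indicator (fun x => ENNReal.ofReal ((x ^ 2)⁻¹) * f x⁻¹) x) :
      0 < x ∧ ENNReal.ofReal ((x / α) ^ 2) ≤ f x⁻¹ := by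
    have hx0 : 0 < x := by
      by_contra hx0
      rw [indicator_of_notMem (notMem_Ioi.2 (not_lt.1 hx0)), nonpos_iff_eq_zero,
        ENNReal.ofReal_eq_zero] at hx
      exact absurd hx (not_le.2 (by positivity))
    refine ⟨hx0, ?_⟩
    rw [indicator_of_mem (mem_Ioi.2 hx0)] at hx
    have := mul_le_mul_right hx (ENNReal.ofReal (x ^ 2))
    rwa [← mul_assoc, ← ENNReal.ofReal_mul (by positivity), ← ENNReal.ofReal_mul (by positivity),
      mul_inv_cancel₀ (by positivity), ENNReal.ofReal_one, one_mul, ← div_eq_mul_inv,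
      ← div_pow] at this
  obtain ⟨hx0, hx⟩ := key hα hx
  obtain ⟨hy0, hy⟩ := key hβ hy
  set m := (1 - l) * x + l * y with hm
  have hm0 : 0 < m := by positivity
  have ht : 1 - l * y / m = (1 - l) * x / m := by
    field_simp
    rw [hm]; ring
  have ht0 : 0 < l * y / m := by positivity
  have ht1 : 0 < 1 - l * y / m := by rw [ht]; positivity
  rw [indicator_of_mem (mem_Ioi.2 hm0)]
  have hle := hfgh x⁻¹ y⁻¹ m⁻¹ (l * y / m) (by positivity) (by positivity) (by positivity)
    ⟨ht0, by linarith⟩ (by rw [ht]; field_simp) (by field_simp)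
  have hle' : ENNReal.ofReal ((m / ((1 - l) * α + l * β)) ^ 2) ≤ h m⁻¹ := by
    refine le_trans ?_ ((mul_le_mul' (ENNReal.rpow_le_rpow hx ht1.le)
      (ENNReal.rpow_le_rpow hy ht0.le)).trans hle)
    rw [ENNReal.ofReal_rpow_of_nonneg (by positivity) ht1.le,
      ENNReal.ofReal_rpow_of_nonneg (by positivity) ht0.le, ← ENNReal.ofReal_mul (by positivity)]
    refine ENNReal.ofReal_le_ofReal ?_
    rw [← Real.rpow_natCast_mul (by positivity), ← Real.rpow_natCast_mul (by positivity),
      mul_comm _ (1 - _), mul_comm _ (l * y / m), Real.rpow_mul_natCast (by positivity),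
      Real.rpow_mul_natCast (by positivity), ← mul_pow]
    refine pow_le_pow_left₀ (by positivity) ?_ 2
    have := Real.geom_mean_le_arith_mean2_weighted ht1.le ht0.le (p₁ := α / x) (p₂ := β / y)
      (by positivity) (by positivity) (by ring)
    rw [← inv_div α x, ← inv_div β y, Real.inv_rpow (by positivity), Real.inv_rpow (by positivity),
      ← mul_inv, ← inv_div _ m]
    refine inv_anti₀ (by positivity) (this.trans_eq ?_)
    rw [ht]
    field_simp
  calc ENNReal.ofReal ((((1 - l) * α + l * β) ^ 2)⁻¹)
      = ENNReal.ofReal ((m ^ 2)⁻¹) * ENNReal.ofReal ((m / ((1 - l) * α + l * β)) ^ 2) := by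
        rw [← ENNReal.ofReal_mul (by positivity)]
        congr 1
        field_simp
    _ ≤ _ := by gcongr

/-- Integrals over subsets of a half-space with respect to the Hausdorff measure, in Cartesian
coordinates; the constant depends only on the dimension. -/
theorem exists_setLIntegral_hausdorffMeasure_eq (n : ℕ) :
    ∃ c : ENNReal, c ≠ 0 ∧ c ≠ ⊤ ∧ ∀ {V : Type*} [NormedAddCommGroup V] [InnerProductSpace ℝ V]
      [MeasurableSpace V] [BorelSpace V] {b : Fin n → V} {u : V} {K : Set V} {φ : V → ENNReal},
      Orthonormal ℝ b → u ≠ 0 → (∀ i, inner ℝ (b i) u = 0) → MeasurableSet K → Measurable φ →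
      (∀ v ∈ K, ∃ (r : ℝ) (y : Fin n → ℝ), 0 ≤ r ∧ v = r • u + ∑ i, y i • b i) →
      ∫⁻ v in K, φ v ∂μH[(n + 1 : ℝ)] = c * ENNReal.ofReal ‖u‖ *
        ∫⁻ r in Ioi (0 : ℝ), ∫⁻ y : Fin n → ℝ, K.indicator φ (r • u + ∑ i, y i • b i) := by
  have hhaar : (μH[(n + 1 : ℝ)] : Measure (EuclideanSpace ℝ (Fin (n + 1)))).IsAddHaarMeasure := by
    simpa using isAddHaarMeasure_hausdorffMeasure (E := EuclideanSpace ℝ (Fin (n + 1)))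
  set c := Measure.addHaarScalarFactor
    (μH[(n + 1 : ℝ)] : Measure (EuclideanSpace ℝ (Fin (n + 1)))) volume with hc
  have hμ : (μH[(n + 1 : ℝ)] : Measure (EuclideanSpace ℝ (Fin (n + 1)))) = c • volume :=
    Measure.isAddLeftInvariant_eq_smul _ _
  have hc0 : 0 < c := Measure.addHaarScalarFactor_pos_of_isAddHaarMeasure _ _
  refine ⟨c, by exact_mod_cast hc0.ne', ENNReal.coe_ne_top, ?_⟩
  intro V _ _ _ _ b u K φ hb hu hbu hK hφ hKu
  have hu' : 0 < ‖u‖ := norm_pos_iff.2 hu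
  set w : Fin (n + 1) → V := Fin.cons (‖u‖⁻¹ • u) b with hw
  have hwo : Orthonormal ℝ w := by
    rw [orthonormal_iff_ite]
    intro i j
    have hbo := orthonormal_iff_ite.1 hb
    refine Fin.cases ?_ (fun i => ?_) i <;> refine Fin.cases ?_ (fun j => ?_) j
    · simp [hw, norm_smul, hu'.ne']
    · simp [hw, real_inner_smul_left, real_inner_comm (b j) u ▸ hbu j, (Fin.succ_ne_zero j).symm]
    · simp [hw, real_inner_smul_right, hbu]
    · simp [hw, hbo, Fin.succ_inj]
  set e := EuclideanSpace.basisFun (Fin (n + 1)) ℝ with he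
  set L : EuclideanSpace ℝ (Fin (n + 1)) →ₗᵢ[ℝ] V :=
    (e.toBasis.constr ℝ w).isometryOfOrthonormal (v := e.toBasis) (by simp)
      (by
        have : ⇑(e.toBasis.constr ℝ w) ∘ ⇑e.toBasis = w := by
          ext i; simp only [Function.comp, Module.Basis.constr_basis]
        rwa [this])
  have hLw (z : EuclideanSpace ℝ (Fin (n + 1))) : L z = ∑ i, z i • w i := by
    have : L z = e.toBasis.constr ℝ w z := rfl
    rw [this, Module.Basis.constr_apply_fintype]
    simp [he]
  have hmeas : Measurable (K.indicator φ) := hφ.indicator hK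
  have hcont : Continuous fun p : ℝ × (Fin n → ℝ) => p.1 • u + ∑ i, p.2 i • b i := by fun_prop
  have hKL : K ⊆ range L := by
    intro v hv
    obtain ⟨r, y, -, rfl⟩ := hKu v hv
    refine ⟨WithLp.toLp 2 (Fin.cons (r * ‖u‖) y), ?_⟩
    rw [hLw, Fin.sum_univ_succ]
    simp [hw, smul_smul, hu'.ne']
  have hneg (r : ℝ) (hr : r < 0) (y : Fin n → ℝ) : K.indicator φ (r • u + ∑ i, y i • b i) = 0 := by
    refine indicator_of_notMem (fun hv => ?_) _
    obtain ⟨r', y', hr', hrr⟩ := hKu _ hv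
    have := congrArg (fun v => inner ℝ v u) hrr
    simp only [inner_add_left, sum_inner, real_inner_smul_left, hbu, mul_zero,
      Finset.sum_const_zero, add_zero] at this
    have := mul_right_cancel₀ (real_inner_self_eq_norm_sq u ▸ (pow_pos hu' 2).ne') this
    linarith
  set G : ℝ → ENNReal := fun r => ∫⁻ y : Fin n → ℝ, K.indicator φ (r • u + ∑ i, y i • b i) with hG
  have hGm : Measurable G := (hmeas.comp hcont.measurable).lintegral_prod_right'
  have hp := (volume_preserving_piFinSuccAbove (fun _ : Fin (n + 1) => ℝ) 0).symm
  calc ∫⁻ v in K, φ v ∂μH[(n + 1 : ℝ)]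
      = ∫⁻ v, K.indicator φ v ∂(μH[(n + 1 : ℝ)].restrict (range L)) := by
        rw [lintegral_indicator hK, Measure.restrict_restrict hK, inter_eq_left.2 hKL]
    _ = ∫⁻ z, K.indicator φ (L z) ∂μH[(n + 1 : ℝ)] := by
        rw [← L.isometry.map_hausdorffMeasure (.inl (by positivity)),
          lintegral_map hmeas L.continuous.measurable]
    _ = c * ∫⁻ z, K.indicator φ (L z) := by
        rw [hμ]
        exact lintegral_smul_measure _ _
    _ = c * ∫⁻ z : Fin (n + 1) → ℝ, K.indicator φ (∑ i, z i • w i) := by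
        congr 1
        rw [← (PiLp.volume_preserving_ofLp (Fin (n + 1))).lintegral_comp
          (f := fun z : Fin (n + 1) → ℝ => K.indicator φ (∑ i, z i • w i))
          (hmeas.comp (Continuous.measurable (by fun_prop)))]
        simp only [hLw]
    _ = c * ∫⁻ p : ℝ × (Fin n → ℝ), K.indicator φ ((p.1 * ‖u‖⁻¹) • u + ∑ i, p.2 i • b i) := by
        congr 1
        rw [← hp.lintegral_comp
          (f := fun z : Fin (n + 1) → ℝ => K.indicator φ (∑ i, z i • w i))
          (hmeas.comp (Continuous.measurable (by fun_prop)))]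
        refine lintegral_congr fun p => ?_
        rw [Fin.sum_univ_succ]
        simp [hw, smul_smul, MeasurableEquiv.piFinSuccAbove]
    _ = c * ∫⁻ r : ℝ, G (r * ‖u‖⁻¹) := by
        congr 1
        exact lintegral_prod (fun p : ℝ × (Fin n → ℝ) =>
          K.indicator φ ((p.1 * ‖u‖⁻¹) • u + ∑ i, p.2 i • b i))
          (hmeas.comp (Continuous.measurable (by fun_prop))).aemeasurable
    _ = c * (ENNReal.ofReal ‖u‖ * ∫⁻ r, G r) := by
        congr 1
        have := Real.smul_map_volume_mul_right (inv_ne_zero hu'.ne')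
        have hu2 : ENNReal.ofReal ‖u‖ * ENNReal.ofReal |‖u‖⁻¹| = 1 := by
          rw [← ENNReal.ofReal_mul hu'.le, abs_of_pos (inv_pos.2 hu'), mul_inv_cancel₀ hu'.ne',
            ENNReal.ofReal_one]
        conv_rhs => rw [← this]
        rw [lintegral_smul_measure, lintegral_map hGm (by fun_prop), smul_eq_mul,
          ← mul_assoc, hu2, one_mul]
    _ = c * ENNReal.ofReal ‖u‖ * ∫⁻ r in Ioi (0 : ℝ), G r := by
        rw [mul_assoc, setLIntegral_congr Ioi_ae_eq_Ici, ← lintegral_indicator measurableSet_Ici]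
        congr 2
        refine lintegral_congr fun r => ?_
        by_cases hr : r ∈ Ici (0 : ℝ)
        · rw [indicator_of_mem hr]
        · rw [indicator_of_notMem hr]
          simp [hG, hneg r (not_le.1 hr)]

/-- Generalized Busemann theorem: log-concave density, half-spaces, no convexity
assumptions on the sets. -/
theorem generalized_busemann (n : ℕ)
    (ρ : EuclideanSpace ℝ (Fin (n + 2)) → NNReal) (hρ : Measurable ρ)
    (hρconc : ∀ x y : EuclideanSpace ℝ (Fin (n + 2)), ∀ t ∈ Set.Icc (0 : ℝ) 1,
      ρ x ^ (1 - t) * ρ y ^ t ≤ ρ ((1 - t) • x + t • y))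
    (E : Submodule ℝ (EuclideanSpace ℝ (Fin (n + 2))))
    (hE : Module.finrank ℝ E = n)
    (H : EuclideanSpace ℝ (Fin (n + 2)) → Set (EuclideanSpace ℝ (Fin (n + 2))))
    (hH : ∀ u, H u = {v | ∃ e ∈ (E : Set (EuclideanSpace ℝ (Fin (n + 2)))),
      ∃ c : ℝ, 0 ≤ c ∧ v = e + c • u})
    (x₀ x₁ : EuclideanSpace ℝ (Fin (n + 2)))
    (hx₀ : x₀ ∈ Eᗮ) (hx₁ : x₁ ∈ Eᗮ)
    (hind : LinearIndependent ℝ ![x₀, x₁])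
    (l : ℝ) (hl : l ∈ Set.Ioo (0 : ℝ) 1)
    (xl : EuclideanSpace ℝ (Fin (n + 2))) (hxl : xl = (1 - l) • x₀ + l • x₁)
    (K₀ Kl K₁ : Set (EuclideanSpace ℝ (Fin (n + 2))))
    (hK₀m : MeasurableSet K₀) (hKlm : MeasurableSet Kl) (hK₁m : MeasurableSet K₁)
    (hK₀ : K₀ ⊆ H x₀) (hKl : Kl ⊆ H xl) (hK₁ : K₁ ⊆ H x₁)
    (hincl : ∀ t ∈ Set.Ioo (0 : ℝ) 1, ((1 - t) • K₀ + t • K₁) ∩ H xl ⊆ Kl)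
    (I₀ Il I₁ : ENNReal)
    (hI₀ : I₀ = ∫⁻ v in K₀, (ρ v : ENNReal) ∂(μH[(n + 1 : ℝ)]))
    (hIl : Il = ∫⁻ v in Kl, (ρ v : ENNReal) ∂(μH[(n + 1 : ℝ)]))
    (hI₁ : I₁ = ∫⁻ v in K₁, (ρ v : ENNReal) ∂(μH[(n + 1 : ℝ)]))
    (hI₀pos : 0 < I₀) (hIlpos : 0 < Il) (hI₁pos : 0 < I₁)
    (hI₀fin : I₀ ≠ ⊤) (hIlfin : Il ≠ ⊤) (hI₁fin : I₁ ≠ ⊤) :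
    ENNReal.ofReal ‖xl‖ * Il⁻¹
      ≤ ENNReal.ofReal ((1 - l) * ‖x₀‖) * I₀⁻¹ + ENNReal.ofReal (l * ‖x₁‖) * I₁⁻¹ := by
  obtain ⟨c, hc0, hct, hc⟩ := exists_setLIntegral_hausdorffMeasure_eq n
  let b := (stdOrthonormalBasis ℝ E).reindex (finCongr hE)
  let w : Fin n → EuclideanSpace ℝ (Fin (n + 2)) := fun i => b i
  have hw : Orthonormal ℝ w := b.orthonormal.comp_linearIsometry E.subtypeₗᵢ
  have hwE (y : Fin n → ℝ) : ∑ i, y i • w i ∈ E :=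
    E.sum_mem fun i _ => E.smul_mem _ (b i).2
  have hx : (x₀ ≠ 0 ∧ x₁ ≠ 0) ∧ xl ≠ 0 := by
    refine ⟨⟨hind.ne_zero 0, hind.ne_zero 1⟩, fun h => ?_⟩
    have := (LinearIndependent.pair_iff.1 hind) (1 - l) l (hxl ▸ h)
    linarith [this.2, hl.1]
  have hxlE : xl ∈ Eᗮ := hxl ▸ Eᗮ.add_mem (Eᗮ.smul_mem _ hx₀) (Eᗮ.smul_mem _ hx₁)
  have hρ' : Measurable fun v => (ρ v : ENNReal) := hρ.coe_nnreal_ennreal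
  have hpar {u : EuclideanSpace ℝ (Fin (n + 2))} {K : Set (EuclideanSpace ℝ (Fin (n + 2)))}
      (hu : u ≠ 0) (huE : u ∈ Eᗮ) (hKm : MeasurableSet K) (hK : K ⊆ H u) :=
    hc (φ := fun v => (ρ v : ENNReal)) hw hu
      (fun i => Submodule.inner_right_of_mem_orthogonal (b i).2 huE) hKm hρ' (fun v hv => by
        have hvu := hK hv
        rw [hH] at hvu
        obtain ⟨e, he, r, hr, rfl⟩ := hvu
        refine ⟨r, b.repr ⟨e, he⟩, hr, ?_⟩
        have := congrArg Subtype.val (b.sum_repr ⟨e, he⟩)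
        refine (add_comm _ _).trans (congrArg (r • u + ·) ?_)
        simpa [w] using this.symm)
  rw [hpar hx.1.1 hx₀ hK₀m hK₀] at hI₀
  rw [hpar hx.1.2 hx₁ hK₁m hK₁] at hI₁
  rw [hpar hx.2 hxlE hKlm hKl] at hIl
  have hinv {u : EuclideanSpace ℝ (Fin (n + 2))} (hu : u ≠ 0) (J : ENNReal) :
      ENNReal.ofReal ‖u‖ * (c * ENNReal.ofReal ‖u‖ * J)⁻¹ = c⁻¹ * J⁻¹ := by
    have hu0 : ENNReal.ofReal ‖u‖ ≠ 0 := (ENNReal.ofReal_pos.2 (norm_pos_iff.2 hu)).ne'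
    rw [ENNReal.mul_inv (.inl (mul_ne_zero hc0 hu0))
      (.inl (ENNReal.mul_ne_top hct ENNReal.ofReal_ne_top)),
      ENNReal.mul_inv (.inl hc0) (.inl hct), mul_comm c⁻¹, ← mul_assoc, ← mul_assoc,
      ENNReal.mul_inv_cancel hu0 ENNReal.ofReal_ne_top, one_mul]
  rw [ENNReal.ofReal_mul (sub_pos.2 hl.2).le, ENNReal.ofReal_mul hl.1.le, mul_assoc, mul_assoc,
    hI₀, hI₁, hIl, hinv hx.1.1, hinv hx.1.2, hinv hx.2, mul_left_comm, mul_left_comm _ c⁻¹,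
    ← mul_add]
  gcongr
  have hmeas {K : Set (EuclideanSpace ℝ (Fin (n + 2)))} (hK : MeasurableSet K) :
      Measurable (K.indicator fun v => (ρ v : ENNReal)) := hρ'.indicator hK
  have hcont (u : EuclideanSpace ℝ (Fin (n + 2))) :
      Continuous fun p : ℝ × (Fin n → ℝ) => p.1 • u + ∑ i, p.2 i • w i := by fun_prop
  have hcont' (v : EuclideanSpace ℝ (Fin (n + 2))) :
      Continuous fun y : Fin n → ℝ => v + ∑ i, y i • w i := by fun_prop
  refine inv_setLIntegral_Ioi_le hl
    ((hmeas hK₀m).comp (hcont x₀).measurable).lintegral_prod_right'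
    ((hmeas hK₁m).comp (hcont x₁).measurable).lintegral_prod_right'
    ((hmeas hKlm).comp (hcont xl).measurable).lintegral_prod_right'
    fun r s q t hr hs hq ht hrt hst => ?_
  refine prekopaLeindler_pi n t ht _ _ _ ((hmeas hK₀m).comp (hcont' _).measurable)
    ((hmeas hK₁m).comp (hcont' _).measurable) ((hmeas hKlm).comp (hcont' _).measurable)
    fun y z => ?_
  have ht1 : 0 < 1 - t := sub_pos.2 ht.2
  have hsum : q • xl + ∑ i, ((1 - t) • y + t • z) i • w i =
      (1 - t) • (r • x₀ + ∑ i, y i • w i) + t • (s • x₁ + ∑ i, z i • w i) := by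
    simp only [hxl, smul_add, smul_smul, hrt, hst, Pi.add_apply, Pi.smul_apply, smul_eq_mul,
      add_smul, Finset.sum_add_distrib, Finset.smul_sum]
    abel
  by_cases hp₀ : r • x₀ + ∑ i, y i • w i ∈ K₀
  swap
  · rw [indicator_of_notMem hp₀, ENNReal.zero_rpow_of_pos ht1, zero_mul]
    exact zero_le
  by_cases hp₁ : s • x₁ + ∑ i, z i • w i ∈ K₁
  swap
  · rw [indicator_of_notMem hp₁, ENNReal.zero_rpow_of_pos ht.1, mul_zero]
    exact zero_le
  have hmem : q • xl + ∑ i, ((1 - t) • y + t • z) i • w i ∈ Kl := by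
    refine hincl t ht ⟨?_, ?_⟩
    · rw [hsum]
      exact add_mem_add (smul_mem_smul_set hp₀) (smul_mem_smul_set hp₁)
    · rw [hH]
      exact ⟨_, hwE _, q, hq.le, add_comm _ _⟩
  rw [indicator_of_mem hp₀, indicator_of_mem hp₁, indicator_of_mem hmem, hsum,
    ← ENNReal.coe_rpow_of_nonneg _ ht1.le, ← ENNReal.coe_rpow_of_nonneg _ ht.1.le,
    ← ENNReal.coe_mul, ENNReal.coe_le_coe]
  exact hρconc _ _ t ⟨ht.1.le, ht.2.le⟩
end

section
/- Let φ, ψ ∈ Cvx₀(ℝⁿ) (lower semicontinuous convex functions with values in [0,∞] vanishing at 0) and λ ∈ (0,1). Define φ ⊡_λ ψ = 𝒜((1−λ)𝒜φ + λ𝒜ψ), where 𝒜 is the polarity transform. Then ∫_{ℝⁿ} e^{−(φ ⊡_λ ψ)} ≥ ( (1−λ)(∫_{ℝⁿ} e^{−φ})⁻¹ + λ(∫_{ℝⁿ} e^{−ψ})⁻¹ )⁻¹. -/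
open MeasureTheory Set Classical
open scoped RealInnerProductSpace ENNReal

variable {n : ℕ}

/-- The polar of a set: `{y | ∀ x ∈ S, ⟪x,y⟫ ≤ 1}`. -/
def polarSet (S : Set (EuclideanSpace ℝ (Fin n))) : Set (EuclideanSpace ℝ (Fin n)) :=
  {y | ∀ x ∈ S, ⟪x, y⟫ ≤ 1}

/-- The polarity transform `𝒜` of a nonnegative function. -/

noncomputable def Apolar (φ : EuclideanSpace ℝ (Fin n) → ℝ≥0∞) :
    EuclideanSpace ℝ (Fin n) → ℝ≥0∞ := fun y =>
  if y = 0 then 0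
  else if y ∈ polarSet {x | φ x = 0} then
    ⨆ (x : EuclideanSpace ℝ (Fin n)) (_ : 0 < φ x), ENNReal.ofReal (⟪x, y⟫ - 1) / φ x
  else ⊤

/-- Membership in `Cvx₀(ℝⁿ)`: lower semicontinuous, convex, nonnegative (values in
`[0,∞]`) and vanishing at the origin. -/
def IsCvx0 (φ : EuclideanSpace ℝ (Fin n) → ℝ≥0∞) : Prop :=
  LowerSemicontinuous φ ∧ φ 0 = 0 ∧
    ∀ x y : EuclideanSpace ℝ (Fin n), ∀ t ∈ Set.Icc (0 : ℝ) 1,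
      φ ((1 - t) • x + t • y) ≤ ENNReal.ofReal (1 - t) * φ x + ENNReal.ofReal t * φ y

/-- `e^{-a}` for `a ∈ [0,∞]`, with `e^{-∞} = 0`. -/
noncomputable def negExp (a : ℝ≥0∞) : ℝ≥0∞ :=
  if a = ⊤ then 0 else ENNReal.ofReal (Real.exp (-a.toReal))

/-- Unnormalized weighted power mean of exponent `-1/k`. -/
noncomputable def powMean (v w k : ℝ) (a b : ℝ≥0∞) : ℝ≥0∞ :=
  (ENNReal.ofReal v * a ^ (-(1 / k)) + ENNReal.ofReal w * b ^ (-(1 / k))) ^ (-k)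

section PowMean

variable {v w k : ℝ}

lemma powMean_zero_left (hv : 0 < v) (hk : 0 < k) (b : ℝ≥0∞) : powMean v w k 0 b = 0 := by
  have h : -(1 / k) < 0 := neg_lt_zero.2 (by positivity)
  rw [powMean, ENNReal.zero_rpow_of_neg h, ENNReal.mul_top (by simpa using hv), top_add,
    ENNReal.top_rpow_of_neg (neg_lt_zero.2 hk)]

lemma powMean_zero_right (hw : 0 < w) (hk : 0 < k) (a : ℝ≥0∞) : powMean v w k a 0 = 0 := by
  have h : -(1 / k) < 0 := neg_lt_zero.2 (by positivity)
  rw [powMean, ENNReal.zero_rpow_of_neg h, ENNReal.mul_top (by simpa using hw), add_top,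
    ENNReal.top_rpow_of_neg (neg_lt_zero.2 hk)]

lemma powMean_mono (hk : 0 < k) {a a' b b' : ℝ≥0∞} (ha : a ≤ a') (hb : b ≤ b') :
    powMean v w k a b ≤ powMean v w k a' b' := by
  unfold powMean
  simp only [ENNReal.rpow_neg]
  gcongr

lemma powMean_one (a b : ℝ≥0∞) :
    powMean v w 1 a b = (ENNReal.ofReal v * a⁻¹ + ENNReal.ofReal w * b⁻¹)⁻¹ := by
  simp [powMean, ENNReal.rpow_neg_one]

lemma powMean_mul (hk : 0 < k) {c : ℝ≥0∞} (hc : c ≠ 0) (hc' : c ≠ ⊤) (a b : ℝ≥0∞) :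
    powMean v w k (c * a) (c * b) = c * powMean v w k a b := by
  have key (x : ℝ≥0∞) : (c * x) ^ (-(1 / k)) = c ^ (-(1 / k)) * x ^ (-(1 / k)) := by
    simp only [ENNReal.rpow_neg]
    rw [ENNReal.mul_rpow_of_nonneg _ _ (by positivity), ENNReal.mul_inv]
    · left; simp [hc, hc']
    · left; simp [hc, hc']
  have hd : c ^ (-(1 / k)) ≠ 0 := by simp [ENNReal.rpow_eq_zero_iff, hc, hc']
  have hd' : c ^ (-(1 / k)) ≠ ⊤ := by simp [ENNReal.rpow_eq_top_iff, hc, hc']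
  unfold powMean
  rw [key, key, mul_left_comm, mul_left_comm (ENNReal.ofReal w), ← mul_add, ENNReal.rpow_neg,
    ENNReal.mul_rpow_of_nonneg _ _ hk.le, ENNReal.mul_inv, ENNReal.rpow_neg _ k,
    ← ENNReal.rpow_neg, ← ENNReal.rpow_mul]
  · congr 1
    rw [show -(1 / k) * -k = 1 by field_simp, ENNReal.rpow_one]
  · left
    rw [Ne, ENNReal.rpow_eq_zero_iff]
    simp only [hd, hd', false_and, or_self, not_false_eq_true]
  · left
    rw [Ne, ENNReal.rpow_eq_top_iff]
    simp only [hd, hd', false_and, or_self, not_false_eq_true]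

lemma continuous_powMean :
    Continuous fun p : ℝ≥0∞ × ℝ≥0∞ => powMean v w k p.1 p.2 := by
  unfold powMean
  refine ENNReal.continuous_rpow_const.comp (Continuous.add ?_ ?_)
  · exact (ENNReal.continuous_const_mul ENNReal.ofReal_ne_top).comp
      (ENNReal.continuous_rpow_const.comp continuous_fst)
  · exact (ENNReal.continuous_const_mul ENNReal.ofReal_ne_top).comp
      (ENNReal.continuous_rpow_const.comp continuous_snd)

lemma rpow_weighted_sum_le (hv : 0 < v) (hw : 0 < w) (hk : 0 < k) {a b A B : ℝ}
    (ha : 0 < a) (hb : 0 < b) (hA : 0 < A) (hB : 0 < B) :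
    (v * a ^ (-(1 / (k + 1))) + w * b ^ (-(1 / (k + 1)))) ^ (k + 1) ≤
      (v * (A / a) + w * (B / b)) * (v * A ^ (-(1 / k)) + w * B ^ (-(1 / k))) ^ k := by
  have hk1 : 0 < k + 1 := by linarith
  have hpq : (k + 1).HolderConjugate ((k + 1) / k) := by
    rw [Real.holderConjugate_iff]
    exact ⟨by linarith, by field_simp; ring⟩
  have h := Real.inner_le_Lp_mul_Lq_of_nonneg (Finset.univ : Finset (Fin 2))
    (f := ![(v * (A / a)) ^ (1 / (k + 1)), (w * (B / b)) ^ (1 / (k + 1))])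
    (g := ![(v * A ^ (-(1 / k))) ^ (k / (k + 1)), (w * B ^ (-(1 / k))) ^ (k / (k + 1))]) hpq
    (by intro i _; fin_cases i <;> simp <;> positivity)
    (by intro i _; fin_cases i <;> simp <;> positivity)
  have key (v a A : ℝ) (hv : 0 < v) (ha : 0 < a) (hA : 0 < A) :
      (v * (A / a)) ^ (1 / (k + 1)) * (v * A ^ (-(1 / k))) ^ (k / (k + 1)) =
        v * a ^ (-(1 / (k + 1))) := by
    have hp : 0 < A ^ (-(1 / k)) := by positivity
    apply Real.log_injOn_pos (by simp only [Set.mem_Ioi]; positivity)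
      (by simp only [Set.mem_Ioi]; positivity)
    rw [Real.log_mul (by positivity) (by positivity), Real.log_rpow (by positivity),
      Real.log_rpow (by positivity), Real.log_mul (by positivity) (by positivity),
      Real.log_mul (by positivity) (by positivity), Real.log_mul (by positivity) (by positivity),
      Real.log_div (by positivity) (by positivity), Real.log_rpow hA, Real.log_rpow ha]
    field_simp
    ring
  have hp (x : ℝ) (hx : 0 < x) : (x ^ (1 / (k + 1))) ^ (k + 1) = x := by
    rw [← Real.rpow_mul hx.le, one_div_mul_cancel hk1.ne', Real.rpow_one]
  have hq (x : ℝ) (hx : 0 < x) : (x ^ (k / (k + 1))) ^ ((k + 1) / k) = x := by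
    rw [← Real.rpow_mul hx.le, show k / (k + 1) * ((k + 1) / k) = 1 by field_simp, Real.rpow_one]
  simp only [Fin.sum_univ_two, Matrix.cons_val_zero, Matrix.cons_val_one] at h
  rw [key v a A hv ha hA, key w b B hw hb hB, hp _ (by positivity), hp _ (by positivity),
    hq _ (by positivity), hq _ (by positivity)] at h
  refine (Real.rpow_le_rpow (by positivity) h hk1.le).trans (le_of_eq ?_)
  rw [Real.mul_rpow (by positivity) (by positivity), hp _ (by positivity),
    ← Real.rpow_mul (by positivity)]
  congr 2
  field_simp

lemma powMean_le_mul (hv : 0 < v) (hw : 0 < w) (hk : 0 < k) {a b : ℝ≥0∞}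
    (ha : a ≠ 0) (ha' : a ≠ ⊤) (hb : b ≠ 0) (hb' : b ≠ ⊤) (A B : ℝ≥0∞) :
    powMean v w k A B ≤
      powMean v w (k + 1) a b * (ENNReal.ofReal v * (A / a) + ENNReal.ofReal w * (B / b)) := by
  rcases eq_or_ne A 0 with rfl | hA
  · simp [powMean_zero_left hv hk]
  rcases eq_or_ne B 0 with rfl | hB
  · simp [powMean_zero_right hw hk]
  have hk1 : 0 < k + 1 := by linarith
  lift a to NNReal using ha'
  lift b to NNReal using hb'
  have ha0 : 0 < (a : ℝ) := by simpa [pos_iff_ne_zero] using ha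
  have hb0 : 0 < (b : ℝ) := by simpa [pos_iff_ne_zero] using hb
  obtain ⟨a, rfl⟩ : ∃ a' : ℝ, a = a'.toNNReal := ⟨a, by simp⟩
  obtain ⟨b, rfl⟩ : ∃ b' : ℝ, b = b'.toNNReal := ⟨b, by simp⟩
  have ha0 : 0 < a := by simpa using ha0
  have hb0 : 0 < b := by simpa using hb0
  change powMean v w k A B ≤ powMean v w (k + 1) (ENNReal.ofReal a) (ENNReal.ofReal b) *
    (ENNReal.ofReal v * (A / ENNReal.ofReal a) + ENNReal.ofReal w * (B / ENNReal.ofReal b))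
  have hm : powMean v w (k + 1) (ENNReal.ofReal a) (ENNReal.ofReal b) =
      ENNReal.ofReal
        ((v * a ^ (-(1 / (k + 1))) + w * b ^ (-(1 / (k + 1)))) ^ (-(k + 1))) := by
    rw [powMean, ENNReal.ofReal_rpow_of_pos ha0, ENNReal.ofReal_rpow_of_pos hb0,
      ← ENNReal.ofReal_mul hv.le, ← ENNReal.ofReal_mul hw.le,
      ← ENNReal.ofReal_add (by positivity) (by positivity),
      ENNReal.ofReal_rpow_of_pos (by positivity)]
  have hm0 : powMean v w (k + 1) (ENNReal.ofReal a) (ENNReal.ofReal b) ≠ 0 := by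
    rw [hm, Ne, ENNReal.ofReal_eq_zero, not_le]; positivity
  have hv0 : ENNReal.ofReal v ≠ 0 := by simpa using hv
  have hw0 : ENNReal.ofReal w ≠ 0 := by simpa using hw
  rcases eq_or_ne A ⊤ with rfl | hA'
  · rw [ENNReal.top_div_of_ne_top ENNReal.ofReal_ne_top, ENNReal.mul_top hv0, top_add,
      ENNReal.mul_top hm0]
    exact le_top
  rcases eq_or_ne B ⊤ with rfl | hB'
  · rw [ENNReal.top_div_of_ne_top ENNReal.ofReal_ne_top, ENNReal.mul_top hw0, add_top,
      ENNReal.mul_top hm0]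
    exact le_top
  have hA0 := ENNReal.toReal_pos hA hA'
  have hB0 := ENNReal.toReal_pos hB hB'
  rw [← ENNReal.ofReal_toReal hA', ← ENNReal.ofReal_toReal hB']
  set A' := A.toReal
  set B' := B.toReal
  rw [hm, powMean, ENNReal.ofReal_rpow_of_pos hA0, ENNReal.ofReal_rpow_of_pos hB0,
    ← ENNReal.ofReal_mul hv.le, ← ENNReal.ofReal_mul hw.le,
    ← ENNReal.ofReal_add (by positivity) (by positivity),
    ENNReal.ofReal_rpow_of_pos (by positivity), ← ENNReal.ofReal_div_of_pos ha0,
    ← ENNReal.ofReal_div_of_pos hb0, ← ENNReal.ofReal_mul hv.le, ← ENNReal.ofReal_mul hw.le,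
    ← ENNReal.ofReal_add (by positivity) (by positivity), ← ENNReal.ofReal_mul (by positivity)]
  apply ENNReal.ofReal_le_ofReal
  have h := rpow_weighted_sum_le hv hw hk ha0 hb0 hA0 hB0
  rw [Real.rpow_neg (by positivity), Real.rpow_neg (by positivity) (k + 1), inv_mul_eq_div,
    inv_le_iff_one_le_mul₀ (by positivity), div_mul_eq_mul_div, one_le_div (by positivity)]
  exact h

end PowMean

section BrascampLieb

open Pointwise in
lemma volume_affine_image (v c : ℝ) (hv : 0 < v) (K : Set ℝ) :
    volume ((fun x => v * x + c) '' K) = ENNReal.ofReal v * volume K := by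
  have h : (fun x => v * x + c) '' K = (fun x => x + c) '' (v • K) := by
    rw [← Set.image_smul, Set.image_image]; rfl
  rw [h, Set.image_add_right, measure_preimage_add_right, Measure.addHaar_smul]
  simp [abs_of_pos hv]

lemma volume_add_le_of_isCompact_s13 {v w : ℝ} (hv : 0 < v) (hw : 0 < w) {K L C : Set ℝ}
    (hK : IsCompact K) (hL : IsCompact L) (hK0 : K.Nonempty) (hL0 : L.Nonempty)
    (h : ∀ x ∈ K, ∀ y ∈ L, v * x + w * y ∈ C) :
    ENNReal.ofReal v * volume K + ENNReal.ofReal w * volume L ≤ volume C := by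
  obtain ⟨a, haK, ha⟩ := hK.exists_isGreatest hK0
  obtain ⟨b, hbL, hb⟩ := hL.exists_isLeast hL0
  set P := (fun x => v * x + w * b) '' K
  set Q := (fun y => w * y + v * a) '' L
  have hQ : MeasurableSet Q := (hL.image (by fun_prop)).measurableSet
  have hPQ : P ∪ Q ⊆ C := by
    rintro _ (⟨x, hx, rfl⟩ | ⟨y, hy, rfl⟩)
    · exact h x hx b hbL
    · simpa only [add_comm] using h a haK y hy
  have hinter : P ∩ Q ⊆ {v * a + w * b} := by
    rintro z ⟨⟨x, hx, rfl⟩, ⟨y, hy, hxy⟩⟩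
    have h1 := mul_le_mul_of_nonneg_left (ha hx) hv.le
    have h2 := mul_le_mul_of_nonneg_left (hb hy) hw.le
    simp only [Set.mem_singleton_iff] at *
    linarith
  have hnull : volume (P ∩ Q) = 0 := measure_mono_null hinter (by simp)
  calc _ = volume P + volume Q := by
        rw [volume_affine_image v _ hv, volume_affine_image w _ hw]
    _ = volume (P ∪ Q) := by rw [← measure_union_add_inter P hQ, hnull, add_zero]
    _ ≤ volume C := measure_mono hPQ

/-- One-dimensional Brunn–Minkowski inequality. -/
lemma volume_add_le_s13 {v w : ℝ} (hv : 0 < v) (hw : 0 < w) {A B C : Set ℝ}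
    (hA : MeasurableSet A) (hB : MeasurableSet B) (hA0 : A.Nonempty) (hB0 : B.Nonempty)
    (h : ∀ x ∈ A, ∀ y ∈ B, v * x + w * y ∈ C) :
    ENNReal.ofReal v * volume A + ENNReal.ofReal w * volume B ≤ volume C := by
  obtain ⟨x₀, hx₀⟩ := hA0
  obtain ⟨y₀, hy₀⟩ := hB0
  have key (S : Set ℝ) (hS : MeasurableSet S) :
      volume S = ⨆ K : {K : Set ℝ // K ⊆ S ∧ IsCompact K}, volume K.1 := by
    rw [hS.measure_eq_iSup_isCompact, iSup_subtype]
    simp only [iSup_and]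
  have (S : Set ℝ) : Nonempty {K : Set ℝ // K ⊆ S ∧ IsCompact K} :=
    ⟨⟨∅, Set.empty_subset _, isCompact_empty⟩⟩
  rw [key A hA, key B hB, ENNReal.mul_iSup, ENNReal.mul_iSup, ENNReal.iSup_add]
  refine iSup_le fun K => ?_
  rw [ENNReal.add_iSup]
  refine iSup_le fun L => ?_
  refine le_trans ?_ (volume_add_le_of_isCompact_s13 hv hw (K.2.2.insert x₀) (L.2.2.insert y₀)
    (Set.insert_nonempty _ _) (Set.insert_nonempty _ _) (C := C) ?_)
  · gcongr <;> exact Set.subset_insert _ _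
  · exact fun x hx y hy => h x (Set.insert_subset hx₀ K.2.1 hx) y (Set.insert_subset hy₀ L.2.1 hy)

lemma volume_pos_ofReal_le (e : ℝ≥0∞) :
    volume {t : ℝ | 0 < t ∧ ENNReal.ofReal t ≤ e} = e := by
  rcases eq_or_ne e ⊤ with rfl | he
  · simp only [le_top, and_true]
    exact Real.volume_Ioi
  · have : {t : ℝ | 0 < t ∧ ENNReal.ofReal t ≤ e} = Set.Ioc 0 e.toReal := by
      ext t
      simp only [Set.mem_ofPred_eq, Set.mem_Ioc, ENNReal.ofReal_le_iff_le_toReal he]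
    rw [this, Real.volume_Ioc, sub_zero, ENNReal.ofReal_toReal he]

/-- Layer cake formula with levels rescaled by `c`. -/
lemma lintegral_eq_mul_lintegral_meas_le {α : Type*} [MeasurableSpace α] {μ : Measure α}
    [SFinite μ] {F : α → ℝ≥0∞} (hF : Measurable F) {c : ℝ≥0∞} (hc : c ≠ 0) (hc' : c ≠ ⊤) :
    ∫⁻ x, F x ∂μ = c * ∫⁻ t in Set.Ioi (0 : ℝ), μ {x | ENNReal.ofReal t * c ≤ F x} := by
  have hS : MeasurableSet {p : ℝ × α | ENNReal.ofReal p.1 * c ≤ F p.2} :=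
    measurableSet_le (by fun_prop) (by fun_prop)
  have h1 (t : ℝ) : μ {x | ENNReal.ofReal t * c ≤ F x} =
      ∫⁻ x, {p : ℝ × α | ENNReal.ofReal p.1 * c ≤ F p.2}.indicator 1 (t, x) ∂μ := by
    rw [← lintegral_indicator_one (measurableSet_le (by fun_prop) hF)]
    rfl
  simp_rw [h1]
  rw [lintegral_lintegral_swap, ← lintegral_const_mul' _ _ hc']
  · refine lintegral_congr fun x => ?_
    have h2 : ∫⁻ t in Set.Ioi (0 : ℝ),
        {p : ℝ × α | ENNReal.ofReal p.1 * c ≤ F p.2}.indicator 1 (t, x) =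
        volume {t : ℝ | 0 < t ∧ ENNReal.ofReal t ≤ F x / c} := by
      have hm : MeasurableSet {t : ℝ | ENNReal.ofReal t * c ≤ F x} :=
        measurableSet_le (by fun_prop) (by fun_prop)
      have : ∀ t : ℝ, {p : ℝ × α | ENNReal.ofReal p.1 * c ≤ F p.2}.indicator
          (1 : ℝ × α → ℝ≥0∞) (t, x) = {t : ℝ | ENNReal.ofReal t * c ≤ F x}.indicator 1 t :=
        fun t => rfl
      simp_rw [this]
      rw [lintegral_indicator_one hm, Measure.restrict_apply hm]
      congr 1
      ext t
      simp only [Set.mem_inter_iff, Set.mem_ofPred_eq, Set.mem_Ioi,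
        ENNReal.le_div_iff_mul_le (Or.inl hc) (Or.inl hc')]
      exact and_comm
    rw [h2, volume_pos_ofReal_le, ENNReal.mul_div_cancel hc hc']
  · exact ((measurable_const.indicator hS)).aemeasurable

variable {v w k : ℝ}

lemma brascampLieb_real_of_bounded (hv : 0 < v) (hw : 0 < w) (hk : 0 < k) {f g h : ℝ → ℝ≥0∞}
    (hf : Measurable f) (hg : Measurable g) (hh : Measurable h)
    (hfb : ⨆ x, f x ≠ ⊤) (hgb : ⨆ x, g x ≠ ⊤)
    (H : ∀ x y, powMean v w (k + 1) (f x) (g y) ≤ h (v * x + w * y)) :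
    powMean v w k (∫⁻ x, f x) (∫⁻ x, g x) ≤ ∫⁻ x, h x := by
  set a := ⨆ x, f x with ha
  set b := ⨆ x, g x with hb
  have hk1 : 0 < k + 1 := by linarith
  rcases eq_or_ne a 0 with ha0 | ha0
  · have : ∀ x, f x = 0 := fun x => le_antisymm (ha0 ▸ le_iSup f x) zero_le
    simp [this, powMean_zero_left hv hk]
  rcases eq_or_ne b 0 with hb0 | hb0
  · have : ∀ x, g x = 0 := fun x => le_antisymm (hb0 ▸ le_iSup g x) zero_le
    simp [this, powMean_zero_right hw hk]
  set m := powMean v w (k + 1) a b with hm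
  rcases eq_or_ne m 0 with hm0 | hm0
  · refine (powMean_le_mul hv hw hk ha0 hfb hb0 hgb _ _).trans ?_
    rw [← hm, hm0, zero_mul]
    exact zero_le
  have hm' : m ≠ ⊤ := by
    rw [hm, powMean, Ne, ENNReal.rpow_eq_top_iff]
    simp only [neg_lt_zero, hk1, and_true, Left.neg_pos_iff, hk1.not_gt, and_false, or_false]
    intro h0
    have h1 := (mul_eq_zero.1 (add_eq_zero.1 h0).1).resolve_left (by simpa using hv)
    rw [ENNReal.rpow_eq_zero_iff] at h1
    exact h1.elim (fun h => ha0 h.1) fun h => hfb h.1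
  refine (powMean_le_mul hv hw hk ha0 hfb hb0 hgb _ _).trans ?_
  rw [lintegral_eq_mul_lintegral_meas_le hf ha0 hfb, lintegral_eq_mul_lintegral_meas_le hg hb0 hgb,
    lintegral_eq_mul_lintegral_meas_le hh hm0 hm', mul_comm a, mul_comm b,
    ENNReal.mul_div_cancel_right ha0 hfb, ENNReal.mul_div_cancel_right hb0 hgb,
    ← lintegral_const_mul' _ _ ENNReal.ofReal_ne_top,
    ← lintegral_const_mul' _ _ ENNReal.ofReal_ne_top, ← lintegral_add_left]
  swap
  · refine measurable_const.mul (Antitone.measurable fun s t hst => measure_mono ?_)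
    intro x hx
    simp only [Set.mem_ofPred_eq] at hx ⊢
    exact le_trans (by gcongr) hx
  refine mul_le_mul_right (lintegral_mono_ae ?_) _
  filter_upwards [ae_restrict_mem measurableSet_Ioi,
    ae_restrict_of_ae (Measure.ae_ne volume (1 : ℝ))] with t ht ht1
  have ht : 0 < t := ht
  rcases lt_or_gt_of_ne ht1 with ht1 | ht1
  · have ht0 : ENNReal.ofReal t ≠ 0 := by simpa using ht
    have ht1' : ENNReal.ofReal t < 1 := by simpa using ht1
    have hlt {c : ℝ≥0∞} (hc : c ≠ 0) (hc' : c ≠ ⊤) : ENNReal.ofReal t * c < c := by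
      simpa using ENNReal.mul_lt_mul_left hc hc' ht1'
    refine volume_add_le_s13 hv hw (measurableSet_le measurable_const hf)
      (measurableSet_le measurable_const hg) ?_ ?_ ?_
    · obtain ⟨x, hx⟩ := lt_iSup_iff.1 (hlt ha0 hfb)
      exact ⟨x, hx.le⟩
    · obtain ⟨x, hx⟩ := lt_iSup_iff.1 (hlt hb0 hgb)
      exact ⟨x, hx.le⟩
    · intro x hx y hy
      refine le_trans ?_ (H x y)
      rw [hm, ← powMean_mul hk1 ht0 ENNReal.ofReal_ne_top]
      exact powMean_mono hk1 hx hy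
  · have ht1' : 1 < ENNReal.ofReal t := by simpa using ht1
    have hlt {c : ℝ≥0∞} (hc : c ≠ 0) (hc' : c ≠ ⊤) : c < ENNReal.ofReal t * c := by
      simpa using ENNReal.mul_lt_mul_left hc hc' ht1'
    have hfe : {x | ENNReal.ofReal t * a ≤ f x} = ∅ :=
      Set.eq_empty_of_forall_notMem fun x hx =>
        (hlt ha0 hfb).not_ge (le_trans hx (le_iSup f x))
    have hge : {x | ENNReal.ofReal t * b ≤ g x} = ∅ :=
      Set.eq_empty_of_forall_notMem fun x hx =>
        (hlt hb0 hgb).not_ge (le_trans hx (le_iSup g x))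
    simp [hfe, hge]

lemma tendsto_lintegral_min_natCast {α : Type*} [MeasurableSpace α] {μ : Measure α}
    {f : α → ℝ≥0∞} (hf : Measurable f) :
    Filter.Tendsto (fun m : ℕ => ∫⁻ x, min (f x) m ∂μ) Filter.atTop (nhds (∫⁻ x, f x ∂μ)) := by
  refine lintegral_tendsto_of_tendsto_of_monotone (fun m => (by fun_prop)) ?_ ?_
  · exact Filter.Eventually.of_forall fun x m m' h => min_le_min_left _ (by exact_mod_cast h)
  · refine Filter.Eventually.of_forall fun x => ?_
    simpa using (tendsto_const_nhds (x := f x)).min ENNReal.tendsto_nat_nhds_top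

/-- One-dimensional Borell–Brascamp–Lieb inequality. -/
lemma brascampLieb_real (hv : 0 < v) (hw : 0 < w) (hk : 0 < k) {f g h : ℝ → ℝ≥0∞}
    (hf : Measurable f) (hg : Measurable g) (hh : Measurable h)
    (H : ∀ x y, powMean v w (k + 1) (f x) (g y) ≤ h (v * x + w * y)) :
    powMean v w k (∫⁻ x, f x) (∫⁻ x, g x) ≤ ∫⁻ x, h x := by
  refine le_of_tendsto' ((continuous_powMean.tendsto _).comp
    ((tendsto_lintegral_min_natCast hf).prodMk_nhds (tendsto_lintegral_min_natCast hg)))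
    fun m => ?_
  refine brascampLieb_real_of_bounded hv hw hk (by fun_prop) (by fun_prop) hh ?_ ?_ fun x y => ?_
  · exact ((iSup_le fun x => min_le_right _ _).trans_lt (ENNReal.natCast_lt_top m)).ne
  · exact ((iSup_le fun x => min_le_right _ _).trans_lt (ENNReal.natCast_lt_top m)).ne
  · exact (powMean_mono (by linarith) (min_le_left _ _) (min_le_left _ _)).trans (H x y)

/-- Borell–Brascamp–Lieb inequality for negative exponents. -/
lemma brascampLieb_pi (hv : 0 < v) (hw : 0 < w) (N : ℕ) :
    ∀ {k : ℝ}, 0 < k → ∀ {f g h : (Fin N → ℝ) → ℝ≥0∞},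
      Measurable f → Measurable g → Measurable h →
      (∀ x y, powMean v w (k + N) (f x) (g y) ≤ h (v • x + w • y)) →
      powMean v w k (∫⁻ x, f x) (∫⁻ x, g x) ≤ ∫⁻ x, h x := by
  induction N with
  | zero =>
    intro k hk f g h hf hg hh H
    simp only [Measure.volume_pi_eq_dirac (α := fun _ : Fin 0 => ℝ) 0, lintegral_dirac]
    simpa using H 0 0
  | succ N ih =>
    intro k hk f g h hf hg hh H
    have hsymm (p : ℝ × (Fin N → ℝ)) :
        (MeasurableEquiv.piFinSuccAbove (fun _ : Fin (N + 1) => ℝ) 0).symm p =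
          Fin.cons p.1 p.2 := by
      simp [MeasurableEquiv.piFinSuccAbove, Fin.insertNthEquiv]
    have hcons : Measurable fun p : ℝ × (Fin N → ℝ) => (Fin.cons p.1 p.2 : Fin (N + 1) → ℝ) := by
      simp_rw [← hsymm]
      exact MeasurableEquiv.measurable _
    have hsplit {f : (Fin (N + 1) → ℝ) → ℝ≥0∞} (hf : Measurable f) :
        ∫⁻ x, f x = ∫⁻ t : ℝ, ∫⁻ x : Fin N → ℝ, f (Fin.cons t x) := by
      rw [← (volume_preserving_piFinSuccAbove (fun _ : Fin (N + 1) => ℝ) 0).symm.lintegral_comp hf,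
        Measure.volume_eq_prod]
      simp_rw [hsymm]
      exact lintegral_prod _ (hf.comp hcons).aemeasurable
    rw [hsplit hf, hsplit hg, hsplit hh]
    refine brascampLieb_real hv hw hk (hf.comp hcons).lintegral_prod_right'
      (hg.comp hcons).lintegral_prod_right' (hh.comp hcons).lintegral_prod_right' fun s t => ?_
    have hc (t : ℝ) : Measurable fun x : Fin N → ℝ => (Fin.cons t x : Fin (N + 1) → ℝ) :=
      hcons.comp measurable_prodMk_left
    refine ih (by linarith) (hf.comp (hc s)) (hg.comp (hc t)) (hh.comp (hc _)) fun x y => ?_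
    have h1 := H (Fin.cons s x) (Fin.cons t y)
    have h2 : v • (Fin.cons s x : Fin (N + 1) → ℝ) + w • (Fin.cons t y : Fin (N + 1) → ℝ) =
        Fin.cons (v * s + w * t) (v • x + w • y) := by
      ext i
      refine Fin.cases ?_ (fun j => ?_) i <;> simp
    rw [h2] at h1
    convert h1 using 2
    push_cast
    ring

end BrascampLieb

section Polarity

variable {v w p q : ℝ} {φ ψ : EuclideanSpace ℝ (Fin n) → ℝ≥0∞}

lemma measurable_Apolar (φ : EuclideanSpace ℝ (Fin n) → ℝ≥0∞) : Measurable (Apolar φ) := by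
  have h0 : MeasurableSet {y : EuclideanSpace ℝ (Fin n) | y = 0} := measurableSet_singleton 0
  have hpol : MeasurableSet (polarSet {x | φ x = 0}) := by
    have : polarSet {x | φ x = 0} = ⋂ x ∈ {x | φ x = 0}, {y | ⟪x, y⟫ ≤ 1} := by
      ext y
      simp [polarSet]
    rw [this]
    exact (isClosed_biInter fun x _ =>
      isClosed_le (by fun_prop) continuous_const).measurableSet
  refine Measurable.ite h0 measurable_const (Measurable.ite hpol ?_ measurable_const)
  refine (lowerSemicontinuous_iSup fun x =>
    lowerSemicontinuous_iSup fun hx => Continuous.lowerSemicontinuous ?_).measurable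
  exact (ENNReal.continuous_div_const _ hx.ne').comp (ENNReal.continuous_ofReal.comp (by fun_prop))

lemma ofReal_inner_sub_one_le {x y : EuclideanSpace ℝ (Fin n)} (hx : φ x ≠ ⊤)
    (hy : Apolar φ y ≠ ⊤) : ENNReal.ofReal (⟪x, y⟫ - 1) ≤ Apolar φ y * φ x := by
  rcases eq_or_ne y 0 with rfl | hy0
  · simp [ENNReal.ofReal_of_nonpos]
  by_cases hpol : y ∈ polarSet {x | φ x = 0}
  · rcases eq_or_ne (φ x) 0 with h0 | h0
    · rw [ENNReal.ofReal_of_nonpos (by linarith [hpol x h0])]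
      exact zero_le
    · rw [← ENNReal.div_le_iff_le_mul (Or.inl h0) (Or.inl hx)]
      simp only [Apolar, hy0, hpol, if_true, if_false]
      exact le_iSup₂ (f := fun x (_ : 0 < φ x) => ENNReal.ofReal (⟪x, y⟫ - 1) / φ x) x
        (pos_iff_ne_zero.2 h0)
  · simp [Apolar, hy0, hpol] at hy

lemma Apolar_le_of_forall {F : EuclideanSpace ℝ (Fin n) → ℝ≥0∞} {z : EuclideanSpace ℝ (Fin n)}
    {c : ℝ≥0∞} (h : ∀ y, F y ≠ ⊤ → ENNReal.ofReal (⟪y, z⟫ - 1) ≤ F y * c) : Apolar F z ≤ c := by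
  rcases eq_or_ne z 0 with rfl | hz
  · simp [Apolar]
  have hpol : z ∈ polarSet {y | F y = 0} := by
    intro y hy
    have hy : F y = 0 := hy
    have := h y (by simp [hy])
    rw [hy, zero_mul, nonpos_iff_eq_zero, ENNReal.ofReal_eq_zero] at this
    linarith
  simp only [Apolar, hz, hpol, if_true, if_false]
  refine iSup₂_le fun y hy => ?_
  rcases eq_or_ne (F y) ⊤ with hT | hT
  · simp [hT]
  · rw [ENNReal.div_le_iff_le_mul (Or.inl hy.ne') (Or.inl hT), mul_comm]
    exact h y hT

lemma Apolar_add_le (hv : 0 < v) (hw : 0 < w) (hp : 0 < p) (hq : 0 < q)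
    {x y : EuclideanSpace ℝ (Fin n)} (hx : φ (p⁻¹ • x) ≤ ENNReal.ofReal p⁻¹)
    (hy : ψ (q⁻¹ • y) ≤ ENNReal.ofReal q⁻¹) :
    Apolar (fun y => ENNReal.ofReal v * Apolar φ y + ENNReal.ofReal w * Apolar ψ y)
      ((v * p + w * q)⁻¹ • (v • x + w • y)) ≤ ENNReal.ofReal (v * p + w * q)⁻¹ := by
  have hr : 0 < v * p + w * q := by positivity
  refine Apolar_le_of_forall fun z hz => ?_
  obtain ⟨hz1, hz2⟩ := ENNReal.add_ne_top.1 hz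
  have hf : Apolar φ z ≠ ⊤ := fun h => hz1 (by rw [h, ENNReal.mul_top (by simpa using hv)])
  have hg : Apolar ψ z ≠ ⊤ := fun h => hz2 (by rw [h, ENNReal.mul_top (by simpa using hw)])
  have h1 := (ofReal_inner_sub_one_le (ne_top_of_le_ne_top ENNReal.ofReal_ne_top hx) hf).trans
    (mul_le_mul_right hx _)
  have h2 := (ofReal_inner_sub_one_le (ne_top_of_le_ne_top ENNReal.ofReal_ne_top hy) hg).trans
    (mul_le_mul_right hy _)
  change _ ≤ (ENNReal.ofReal v * Apolar φ z + ENNReal.ofReal w * Apolar ψ z) * _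
  rw [← ENNReal.ofReal_toReal hf] at h1 ⊢
  rw [← ENNReal.ofReal_toReal hg] at h2 ⊢
  set a := (Apolar φ z).toReal
  set b := (Apolar ψ z).toReal
  have ha : 0 ≤ a := ENNReal.toReal_nonneg
  have hb : 0 ≤ b := ENNReal.toReal_nonneg
  rw [← ENNReal.ofReal_mul ha, ENNReal.ofReal_le_ofReal_iff (by positivity), inner_smul_left,
    RCLike.conj_to_real, sub_le_iff_le_add, inv_mul_le_iff₀ hp] at h1
  rw [← ENNReal.ofReal_mul hb, ENNReal.ofReal_le_ofReal_iff (by positivity), inner_smul_left,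
    RCLike.conj_to_real, sub_le_iff_le_add, inv_mul_le_iff₀ hq] at h2
  rw [← ENNReal.ofReal_mul hv.le, ← ENNReal.ofReal_mul hw.le,
    ← ENNReal.ofReal_add (by positivity) (by positivity), ← ENNReal.ofReal_mul (by positivity),
    ENNReal.ofReal_le_ofReal_iff (by positivity), real_inner_comm, inner_smul_left,
    RCLike.conj_to_real, sub_le_iff_le_add, inv_mul_le_iff₀ hr, inner_add_left, inner_smul_left,
    inner_smul_left, RCLike.conj_to_real, RCLike.conj_to_real]
  have h1' : ⟪x, z⟫ ≤ a + p := h1.trans (le_of_eq (by field_simp))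
  have h2' : ⟪y, z⟫ ≤ b + q := h2.trans (le_of_eq (by field_simp))
  calc v * ⟪x, z⟫ + w * ⟪y, z⟫ ≤ v * (a + p) + w * (b + q) := by gcongr
    _ = _ := by field_simp; ring

end Polarity

section Slices

/-- The density on `ℝ × ℝⁿ` whose total mass is `∫ e^{-F}`, obtained from the measure
`e^{-s} dx ds` on the epigraph of `F` under the change of variables `(p, u) = (1/s, x/s)`. -/
noncomputable def epiDensity (F : EuclideanSpace ℝ (Fin n) → ℝ≥0∞) (p : ℝ)
    (u : EuclideanSpace ℝ (Fin n)) : ℝ≥0∞ :=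
  if 0 < p ∧ F (p⁻¹ • u) ≤ ENNReal.ofReal p⁻¹ then
    ENNReal.ofReal ((p * Real.exp (p⁻¹ / (1 + 1 + n))) ^ (-(1 + 1 + n : ℝ)))
  else 0

lemma measurable_epiDensity {F : EuclideanSpace ℝ (Fin n) → ℝ≥0∞} (hF : Measurable F) :
    Measurable fun z : ℝ × EuclideanSpace ℝ (Fin n) => epiDensity F z.1 z.2 := by
  refine Measurable.ite ?_ (by fun_prop) measurable_const
  refine (measurableSet_lt measurable_const measurable_fst).inter
    (measurableSet_le (hF.comp (measurable_fst.inv.smul measurable_snd)) (by fun_prop))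

lemma negExp_eq_lintegral (a : ℝ≥0∞) :
    negExp a = ∫⁻ s in Ioi (0 : ℝ), if a ≤ ENNReal.ofReal s then
      ENNReal.ofReal (Real.exp (-s)) else 0 := by
  rcases eq_or_ne a ⊤ with rfl | ha
  · simp [negExp]
  have h0 : 0 ≤ a.toReal := ENNReal.toReal_nonneg
  have h1 (s : ℝ) : (Ioi (0 : ℝ)).indicator (fun s => if a ≤ ENNReal.ofReal s then
      ENNReal.ofReal (Real.exp (-s)) else 0) s =
      (Ioi 0 ∩ Ici a.toReal).indicator (fun s => ENNReal.ofReal (Real.exp (-s))) s := by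
    by_cases hs : 0 < s
    · simp [Set.indicator, hs, ENNReal.le_ofReal_iff_toReal_le ha hs.le]
    · simp [Set.indicator, hs]
  have hae : (Ioi 0 ∩ Ici a.toReal : Set ℝ) =ᵐ[volume] Ioi a.toReal := by
    have h2 : (Ioi 0 ∩ Ioi a.toReal : Set ℝ) = Ioi a.toReal :=
      Set.inter_eq_right.2 (Ioi_subset_Ioi h0)
    have := (Filter.EventuallyEq.refl (ae volume) (Ioi (0 : ℝ))).inter
      (Ioi_ae_eq_Ici (μ := volume) (a := a.toReal)).symm
    rwa [h2] at this
  rw [← lintegral_indicator measurableSet_Ioi, lintegral_congr h1,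
    lintegral_indicator (measurableSet_Ioi.inter measurableSet_Ici), setLIntegral_congr hae,
    ← ofReal_integral_eq_lintegral_ofReal (integrableOn_exp_neg_Ioi _)
      (Filter.Eventually.of_forall fun s => (Real.exp_pos _).le), integral_exp_neg_Ioi]
  simp [negExp, ha]

lemma lintegral_negExp_eq_lintegral_meas_le {F : EuclideanSpace ℝ (Fin n) → ℝ≥0∞}
    (hF : Measurable F) :
    ∫⁻ x, negExp (F x) = ∫⁻ s in Ioi (0 : ℝ),
      ENNReal.ofReal (Real.exp (-s)) * volume {x | F x ≤ ENNReal.ofReal s} := by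
  simp_rw [negExp_eq_lintegral]
  rw [lintegral_lintegral_swap]
  · refine lintegral_congr fun s => ?_
    rw [← lintegral_indicator_const (measurableSet_le hF measurable_const)]
    exact lintegral_congr fun x => by simp [Set.indicator]
  · refine Measurable.aemeasurable (Measurable.ite (measurableSet_le ?_ ?_) ?_ measurable_const)
    all_goals fun_prop

lemma lintegral_epiDensity_of_pos {F : EuclideanSpace ℝ (Fin n) → ℝ≥0∞} (hF : Measurable F)
    {p : ℝ} (hp : 0 < p) :
    ∫⁻ u, epiDensity F p u = ENNReal.ofReal |-(p ^ 2)⁻¹| *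
      (ENNReal.ofReal (Real.exp (-p⁻¹)) * volume {x | F x ≤ ENNReal.ofReal p⁻¹}) := by
  have hm : MeasurableSet {x | F x ≤ ENNReal.ofReal p⁻¹} := measurableSet_le hF measurable_const
  have hk : (0 : ℝ) < 1 + 1 + n := by positivity
  have h1 : ∫⁻ u, epiDensity F p u =
      ∫⁻ u, ((fun u : EuclideanSpace ℝ (Fin n) => p⁻¹ • u) ⁻¹'
        {x | F x ≤ ENNReal.ofReal p⁻¹}).indicator (fun _ => ENNReal.ofReal
          ((p * Real.exp (p⁻¹ / (1 + 1 + n))) ^ (-(1 + 1 + n : ℝ)))) u := by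
    refine lintegral_congr fun u => ?_
    simp [epiDensity, hp, Set.indicator]
  rw [h1, lintegral_indicator_const (hm.preimage (by fun_prop)),
    Measure.addHaar_preimage_smul _ (inv_ne_zero hp.ne'), ← mul_assoc, ← mul_assoc,
    ← ENNReal.ofReal_mul (by positivity), ← ENNReal.ofReal_mul (by positivity)]
  congr 2
  rw [finrank_euclideanSpace_fin, inv_pow, inv_inv, abs_of_pos (by positivity), abs_neg,
    abs_of_pos (by positivity), Real.mul_rpow hp.le (Real.exp_pos _).le, ← Real.exp_mul,
    show p⁻¹ / (1 + 1 + n) * -(1 + 1 + n : ℝ) = -p⁻¹ by field_simp, Real.rpow_neg hp.le,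
    show (1 + 1 + n : ℝ) = ((2 + n : ℕ) : ℝ) by push_cast; ring, Real.rpow_natCast, pow_add]
  field_simp

lemma lintegral_negExp_eq_lintegral_epiDensity {F : EuclideanSpace ℝ (Fin n) → ℝ≥0∞}
    (hF : Measurable F) : ∫⁻ x, negExp (F x) = ∫⁻ p, ∫⁻ u, epiDensity F p u := by
  have himg : (fun p : ℝ => p⁻¹) '' Ioi 0 = Ioi 0 := by
    rw [Set.image_inv_eq_inv]
    ext x
    simp
  rw [lintegral_negExp_eq_lintegral_meas_le hF]
  conv_lhs => rw [← himg]
  rw [lintegral_image_eq_lintegral_abs_deriv_mul (f' := fun p => -(p ^ 2)⁻¹) measurableSet_Ioi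
      (fun p hp => (hasDerivAt_inv (ne_of_gt hp)).hasDerivWithinAt) inv_injective.injOn,
    ← lintegral_indicator measurableSet_Ioi]
  refine lintegral_congr fun p => ?_
  by_cases hp : 0 < p
  · rw [Set.indicator_of_mem (show p ∈ Ioi 0 from hp), lintegral_epiDensity_of_pos hF hp]
  · simp [Set.indicator, hp, epiDensity]

lemma perspective_exp_le {v w p q c : ℝ} (hv : 0 < v) (hw : 0 < w) (hvw : v + w = 1)
    (hp : 0 < p) (hq : 0 < q) :
    (v * p + w * q) * Real.exp ((v * p + w * q)⁻¹ / c) ≤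
      v * (p * Real.exp (p⁻¹ / c)) + w * (q * Real.exp (q⁻¹ / c)) := by
  have hr : 0 < v * p + w * q := by positivity
  have ha : 0 ≤ v * p / (v * p + w * q) := by positivity
  have hb : 0 ≤ w * q / (v * p + w * q) := by positivity
  have h := convexOn_exp.2 (Set.mem_univ (p⁻¹ / c)) (Set.mem_univ (q⁻¹ / c)) ha hb (by field_simp)
  have he : (v * p / (v * p + w * q)) • (p⁻¹ / c) + (w * q / (v * p + w * q)) • (q⁻¹ / c) =
      (v * p + w * q)⁻¹ / c := by
    simp only [smul_eq_mul]
    have : (v * p / (v * p + w * q)) * p⁻¹ + (w * q / (v * p + w * q)) * q⁻¹ =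
        (v * p + w * q)⁻¹ := by
      field_simp
      exact hvw
    rw [← this]
    ring
  rw [he] at h
  refine (mul_le_mul_of_nonneg_left h hr.le).trans (le_of_eq ?_)
  simp only [smul_eq_mul]
  field_simp

lemma powMean_epiDensity_le {v w : ℝ} (hv : 0 < v) (hw : 0 < w) (hvw : v + w = 1)
    {φ ψ χ : EuclideanSpace ℝ (Fin n) → ℝ≥0∞}
    (H : ∀ p q x y, 0 < p → 0 < q → φ (p⁻¹ • x) ≤ ENNReal.ofReal p⁻¹ →
      ψ (q⁻¹ • y) ≤ ENNReal.ofReal q⁻¹ →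
      χ ((v * p + w * q)⁻¹ • (v • x + w • y)) ≤ ENNReal.ofReal (v * p + w * q)⁻¹)
    (p q : ℝ) (x y : EuclideanSpace ℝ (Fin n)) :
    powMean v w (1 + 1 + n) (epiDensity φ p x) (epiDensity ψ q y) ≤
      epiDensity χ (v * p + w * q) (v • x + w • y) := by
  have hk : (0 : ℝ) < 1 + 1 + n := by positivity
  by_cases hx : 0 < p ∧ φ (p⁻¹ • x) ≤ ENNReal.ofReal p⁻¹
  swap
  · simp only [epiDensity, hx, if_false, powMean_zero_left hv hk, zero_le]
  by_cases hy : 0 < q ∧ ψ (q⁻¹ • y) ≤ ENNReal.ofReal q⁻¹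
  swap
  · have h0 : epiDensity ψ q y = 0 := if_neg hy
    rw [h0, powMean_zero_right hw hk]
    exact zero_le
  obtain ⟨hp, -⟩ := id hx
  obtain ⟨hq, -⟩ := id hy
  have hr : 0 < v * p + w * q := by positivity
  rw [epiDensity, if_pos hx, epiDensity, if_pos hy, epiDensity,
    if_pos ⟨hr, H p q x y hp hq hx.2 hy.2⟩]
  set k : ℝ := 1 + 1 + n
  have hpow (t : ℝ) (ht : 0 < t) : (t ^ (-k)) ^ (-(1 / k)) = t := by
    rw [← Real.rpow_mul ht.le, show -k * -(1 / k) = 1 by field_simp, Real.rpow_one]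
  rw [powMean, ENNReal.ofReal_rpow_of_pos (by positivity),
    ENNReal.ofReal_rpow_of_pos (by positivity), hpow _ (by positivity), hpow _ (by positivity),
    ← ENNReal.ofReal_mul hv.le, ← ENNReal.ofReal_mul hw.le,
    ← ENNReal.ofReal_add (by positivity) (by positivity),
    ENNReal.ofReal_rpow_of_pos (by positivity)]
  exact ENNReal.ofReal_le_ofReal (Real.rpow_le_rpow_of_nonpos (by positivity)
    (perspective_exp_le hv hw hvw hp hq) (by linarith))

end Slices

/-- Polar Prékopa–Leindler for geometric convex functions:
`∫ e^{-(φ ⊡_λ ψ)} ≥ ((1-λ)(∫e^{-φ})⁻¹ + λ(∫e^{-ψ})⁻¹)⁻¹`, where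
`φ ⊡_λ ψ = 𝒜((1-λ)𝒜φ + λ𝒜ψ)`. -/
theorem polar_prekopa_leindler_cvx0 (n : ℕ)
    (φ ψ : EuclideanSpace ℝ (Fin n) → ℝ≥0∞)
    (hφ : IsCvx0 φ) (hψ : IsCvx0 ψ)
    (l : ℝ) (hl : l ∈ Set.Ioo (0 : ℝ) 1) :
    (ENNReal.ofReal (1 - l) * (∫⁻ x, negExp (φ x))⁻¹ +
      ENNReal.ofReal l * (∫⁻ x, negExp (ψ x))⁻¹)⁻¹
      ≤ ∫⁻ x, negExp
          (Apolar (fun y => ENNReal.ofReal (1 - l) * Apolar φ y +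
            ENNReal.ofReal l * Apolar ψ y) x) := by
  obtain ⟨hl0, hl1⟩ := hl
  have hv : 0 < 1 - l := by linarith
  set χ := Apolar (fun y => ENNReal.ofReal (1 - l) * Apolar φ y + ENNReal.ofReal l * Apolar ψ y)
  have hφm : Measurable φ := hφ.1.measurable
  have hψm : Measurable ψ := hψ.1.measurable
  have hχm : Measurable χ := measurable_Apolar _
  rw [← powMean_one, lintegral_negExp_eq_lintegral_epiDensity hφm,
    lintegral_negExp_eq_lintegral_epiDensity hψm, lintegral_negExp_eq_lintegral_epiDensity hχm]
  refine brascampLieb_real hv hl0 one_pos (measurable_epiDensity hφm).lintegral_prod_right'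
    (measurable_epiDensity hψm).lintegral_prod_right'
    (measurable_epiDensity hχm).lintegral_prod_right' fun p q => ?_
  have hmeas {F : EuclideanSpace ℝ (Fin n) → ℝ≥0∞} (hF : Measurable F) (p : ℝ) :
      Measurable (epiDensity F p) := (measurable_epiDensity hF).comp measurable_prodMk_left
  have hmeas' {F : EuclideanSpace ℝ (Fin n) → ℝ≥0∞} (hF : Measurable F) (p : ℝ) :
      Measurable fun u : Fin n → ℝ => epiDensity F p (WithLp.toLp 2 u) :=
    (hmeas hF p).comp (by fun_prop)
  rw [← (PiLp.volume_preserving_toLp (Fin n)).lintegral_comp (hmeas hφm p),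
    ← (PiLp.volume_preserving_toLp (Fin n)).lintegral_comp (hmeas hψm q),
    ← (PiLp.volume_preserving_toLp (Fin n)).lintegral_comp (hmeas hχm _)]
  exact brascampLieb_pi hv hl0 n (by norm_num) (hmeas' hφm p) (hmeas' hψm q) (hmeas' hχm _)
    fun x y => powMean_epiDensity_le hv hl0 (by ring)
      (fun _ _ _ _ hp hq hx hy => Apolar_add_le hv hl0 hp hq hx hy) p q _ _
end
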